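/- If H is a Galois-theoretical Hopf algebra over k, then for every n ≥ 1 the semidirect (smash) product Hopf algebra kS_n ⋉ H^{⊗n}, where the symmetric group S_n acts on H^{⊗n} by permuting the tensor factors, is Galois-theoretical. -/

import Mathlib

open TensorProduct

/-- A grouplike element of a Hopf algebra. -/
def IsGrouplike (k : Type) {H : Type} [CommSemiring k] [Semiring H] [HopfAlgebra k H]
    (g : H) : Prop :=
  g ≠ 0 ∧ Coalgebra.comul (R := k) g = g ⊗ₜ[k] g

/-- A Hopf ideal of a Hopf algebra `H` over `k`: a two-sided ideal which is also a coideal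
and is stable under the antipode. -/
structure HopfIdeal (k H : Type) [CommSemiring k] [Semiring H] [HopfAlgebra k H] where
  carrier : Submodule k H
  mul_mem_left : ∀ (a : H) {x : H}, x ∈ carrier → a * x ∈ carrier
  mul_mem_right : ∀ (a : H) {x : H}, x ∈ carrier → x * a ∈ carrier
  comul_mem : ∀ x ∈ carrier, Coalgebra.comul (R := k) x ∈
      (LinearMap.range (TensorProduct.map carrier.subtype (LinearMap.id (M := H))) ⊔
       LinearMap.range (TensorProduct.map (LinearMap.id (M := H)) carrier.subtype))
  counit_eq_zero : ∀ x ∈ carrier, Coalgebra.counit (R := k) x = 0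
  antipode_mem : ∀ x ∈ carrier, HopfAlgebra.antipode (R := k) x ∈ carrier

/-- A (left) action of a Hopf algebra `H` on an algebra `A`, making `A` an `H`-module algebra:
`h ⬝ (a b) = ∑ (h₁ ⬝ a) (h₂ ⬝ b)` and `h ⬝ 1 = ε(h) 1`. -/
structure HopfAction (k H A : Type) [CommSemiring k] [Semiring H] [HopfAlgebra k H]
    [Semiring A] [Algebra k A] where
  act : H →ₐ[k] Module.End k A
  act_mul : ∀ (h : H) (a b : A),
    act h (a * b) = LinearMap.mul' k A
      (TensorProduct.map ((act.toLinearMap : H →ₗ[k] A →ₗ[k] A).flip a)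
        ((act.toLinearMap : H →ₗ[k] A →ₗ[k] A).flip b) (Coalgebra.comul (R := k) h))
  act_one : ∀ h : H, act h (1 : A) = Coalgebra.counit (R := k) h • (1 : A)

/-- A module over a Hopf algebra (given by its structure map `ρ`) is inner faithful if no
nonzero Hopf ideal annihilates it. -/
def InnerFaithful (k : Type) {H M : Type} [CommSemiring k] [Semiring H] [HopfAlgebra k H]
    [AddCommMonoid M] [Module k M] (ρ : H →ₗ[k] Module.End k M) : Prop :=
  ∀ I : HopfIdeal k H, (∀ x ∈ I.carrier, ρ x = 0) → I.carrier = ⊥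

/-- A witness that the Hopf algebra `H` is Galois-theoretical: a field `L ⊇ k` together with an
inner faithful `H`-module algebra structure on `L`. -/
structure GTWitness (k H : Type) [Field k] [Semiring H] [HopfAlgebra k H] : Type 1 where
  L : Type
  [fieldL : Field L]
  [algL : Algebra k L]
  action : HopfAction k H L
  faithful : InnerFaithful k action.act.toLinearMap

/-- A Hopf algebra is Galois-theoretical if it acts inner faithfully and `k`-linearly on a field
containing `k`. -/
def GaloisTheoretical (k H : Type) [Field k] [Semiring H] [HopfAlgebra k H] : Prop :=
  Nonempty (GTWitness k H)

/-- The set of invariants of a Hopf algebra action. -/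
def HopfAction.invariants {k H A : Type} [CommSemiring k] [Semiring H] [HopfAlgebra k H]
    [Semiring A] [Algebra k A] (ha : HopfAction k H A) : Set A :=
  {a : A | ∀ h : H, ha.act h a = Coalgebra.counit (R := k) h • a}

/-- A subcoalgebra: a subspace `V` with `Δ(V) ⊆ V ⊗ V`. -/
def IsSubcoalgebra (k : Type) {H : Type} [CommSemiring k] [Semiring H] [HopfAlgebra k H]
    (V : Submodule k H) : Prop :=
  ∀ x ∈ V, Coalgebra.comul (R := k) x ∈ LinearMap.range (TensorProduct.map V.subtype V.subtype)

/-- A simple subcoalgebra: a nonzero subcoalgebra with no nonzero proper subcoalgebras. -/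
def IsSimpleSubcoalgebra (k : Type) {H : Type} [CommSemiring k] [Semiring H] [HopfAlgebra k H]
    (V : Submodule k H) : Prop :=
  IsSubcoalgebra k V ∧ V ≠ ⊥ ∧
    ∀ W : Submodule k H, IsSubcoalgebra k W → W ≤ V → W = ⊥ ∨ W = V

/-- The coradical of a Hopf algebra: the sum of all its simple subcoalgebras. -/
def coradical (k H : Type) [CommSemiring k] [Semiring H] [HopfAlgebra k H] : Submodule k H :=
  sSup {V : Submodule k H | IsSimpleSubcoalgebra k V}

/-- A Hopf algebra is pointed iff its coradical is spanned by the grouplike elements. -/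
def IsPointedHopf (k H : Type) [CommSemiring k] [Semiring H] [HopfAlgebra k H] : Prop :=
  coradical k H = Submodule.span k {g : H | IsGrouplike k g}

open scoped TensorProduct in
/-- Given data `(π, j)` as in `IsSmashProductPerm` below, the canonical linear map
`k S_n ⊗ H^{⊗ n} → K`, `σ ⊗ (h_1 ⊗ ⋯ ⊗ h_n) ↦ π(σ) j_1(h_1) ⋯ j_n(h_n)`.
(Here the group algebra `k S_n` is taken with its underlying vector space `S_n →₀ k`.) -/
noncomputable def smashProductMap {k H K : Type} [Field k]
    [Ring H] [HopfAlgebra k H] [Ring K] [HopfAlgebra k K] (n : ℕ)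
    (π : Equiv.Perm (Fin n) →* K) (j : Fin n → (H →ₐ[k] K)) :
    ((Equiv.Perm (Fin n) →₀ k) ⊗[k] (⨂[k] _i : Fin n, H)) →ₗ[k] K :=
  TensorProduct.lift (Finsupp.lsum k fun σ : Equiv.Perm (Fin n) =>
    LinearMap.toSpanSingleton k _
      ((LinearMap.mulLeft k (π σ)) ∘ₗ
        (PiTensorProduct.lift
          ((MultilinearMap.mkPiAlgebraFin k n K).compLinearMap fun i => (j i).toLinearMap))))

/-- `K` realizes the semidirect (smash) product Hopf algebra `k S_n ⋉ H^{⊗ n}`, where `S_n`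
permutes the tensor factors: there are a homomorphism `π` from `S_n` to grouplike elements of
`K` and algebra homomorphisms `j i : H → K` (`i = 1, …, n`) which are coalgebra maps, with
commuting images for distinct indices, satisfying the smash-product commutation relation
`π(σ) j_i(h) = j_{σ(i)}(h) π(σ)`, and such that multiplication induces a linear isomorphism
`k S_n ⊗ H^{⊗ n} ≅ K`. -/
structure IsSmashProductPerm (k H K : Type) [Field k]
    [Ring H] [HopfAlgebra k H] [Ring K] [HopfAlgebra k K] (n : ℕ)
    (π : Equiv.Perm (Fin n) →* K) (j : Fin n → (H →ₐ[k] K)) : Prop where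
  grouplike : ∀ σ : Equiv.Perm (Fin n), IsGrouplike k (π σ)
  comul_j : ∀ (i : Fin n) (h : H),
    Coalgebra.comul (R := k) (j i h) =
      TensorProduct.map (j i).toLinearMap (j i).toLinearMap (Coalgebra.comul (R := k) h)
  counit_j : ∀ (i : Fin n) (h : H),
    Coalgebra.counit (R := k) (j i h) = Coalgebra.counit (R := k) h
  commute_j : ∀ (i i' : Fin n), i ≠ i' → ∀ (h h' : H), j i h * j i' h' = j i' h' * j i h
  conj : ∀ (σ : Equiv.Perm (Fin n)) (i : Fin n) (h : H), π σ * j i h = j (σ i) h * π σ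
  bij : Function.Bijective (smashProductMap n π j)

theorem exists_point_aux (k : Type) [Field k] [IsAlgClosed k] (F : Type) [Field F] [Algebra k F]
    [Module.Finite k F] : Nonempty (F →ₐ[k] k) := ⟨IsAlgClosed.lift⟩

theorem exists_point {k : Type} [Field k] [IsAlgClosed k] {A : Type} [Field A] [Algebra k A]
    (s : Set A) (hs : s.Finite) : Nonempty (Algebra.adjoin k s →ₐ[k] k) := by
  set R := Algebra.adjoin k s
  have : Algebra.FiniteType k R := by
    rw [← Subalgebra.fg_iff_finiteType]
    exact ⟨hs.toFinset, by simp [R]⟩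
  obtain ⟨m, hm⟩ := Ideal.exists_maximal R
  have : Algebra.FiniteType k (R ⧸ m) := Algebra.FiniteType.trans (S := R) this inferInstance
  let _ := Ideal.Quotient.field m
  have : Module.Finite k (R ⧸ m) := finite_of_finite_type_of_isJacobsonRing k (R ⧸ m)
  obtain ⟨e⟩ := exists_point_aux k (R ⧸ m)
  exact ⟨e.comp (Ideal.Quotient.mkₐ k m)⟩

theorem noZeroDivisors_tensor_field {k : Type} [Field k] [IsAlgClosed k] {A B : Type} [Field A]
    [Algebra k A] [CommRing B] [IsDomain B] [Algebra k B] (u v : A ⊗[k] B) (huv : u * v = 0)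
    (hu : u ≠ 0) (hv : v ≠ 0) : False := by
  classical
  let b := Module.Basis.ofVectorSpace k B
  let bA := Algebra.TensorProduct.basis A b
  have hu' : bA.repr u ≠ 0 := by simpa using hu
  have hv' : bA.repr v ≠ 0 := by simpa using hv
  obtain ⟨i, hi⟩ := Finsupp.ne_iff.mp hu'
  obtain ⟨l, hl⟩ := Finsupp.ne_iff.mp hv'
  let s : Set A := Set.range (bA.repr u) ∪ Set.range (bA.repr v) ∪ {(bA.repr u i)⁻¹, (bA.repr v l)⁻¹}
  have hs : s.Finite := by
    refine ((Finsupp.finite_range _).union (Finsupp.finite_range _)).union (by simp)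
  obtain ⟨χ⟩ := exists_point (k := k) s hs
  set R := Algebra.adjoin k s
  let φ : R ⊗[k] B →ₐ[k] A ⊗[k] B := Algebra.TensorProduct.map R.val (AlgHom.id k B)
  have hφ : Function.Injective φ := by
    have := Module.Flat.rTensor_preserves_injective_linearMap (M := B) R.val.toLinearMap
      Subtype.val_injective
    exact this
  let ψ : R ⊗[k] B →ₐ[k] B := Algebra.TensorProduct.lift ((Algebra.ofId k B).comp χ) (AlgHom.id k B)
    (fun _ _ => Commute.all _ _)
  have key : ∀ w : A ⊗[k] B, (∀ i, bA.repr w i ∈ s) → ∃ w' : R ⊗[k] B, φ w' = w ∧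
      ∀ i, ∀ h : bA.repr w i ∈ R, b.repr (ψ w') i = χ ⟨_, h⟩ := by
    intro w hw
    have hR : ∀ i, bA.repr w i ∈ R := fun i => Algebra.subset_adjoin (hw i)
    refine ⟨(bA.repr w).support.sum fun i => (⟨_, hR i⟩ : R) ⊗ₜ b i, ?_, ?_⟩
    · rw [map_sum]
      conv_rhs => rw [← bA.linearCombination_repr w, Finsupp.linearCombination_apply, Finsupp.sum]
      refine Finset.sum_congr rfl fun i _ => ?_
      simp [φ, bA, Algebra.TensorProduct.basis_apply, TensorProduct.smul_tmul']
    · intro i h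
      rw [map_sum, map_sum, Finsupp.finsetSum_apply]
      have : ∀ j, b.repr (ψ ((⟨_, hR j⟩ : R) ⊗ₜ b j)) i = if j = i then χ ⟨_, hR j⟩ else 0 := by
        intro j
        simp only [ψ, Algebra.TensorProduct.lift_tmul, AlgHom.comp_apply, Algebra.ofId_apply,
          AlgHom.id_apply, ← Algebra.smul_def]
        simp [Finsupp.single_apply]
      simp only [this]
      rw [Finset.sum_ite_eq']
      split_ifs with h1
      · rfl
      · have h2 : bA.repr w i = 0 := by simpa using h1
        have : (⟨_, h⟩ : R) = 0 := Subtype.ext h2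
        rw [this, map_zero]
  obtain ⟨u', hu1, hu2⟩ := key u (fun i => Or.inl (Or.inl ⟨i, rfl⟩))
  obtain ⟨v', hv1, hv2⟩ := key v (fun i => Or.inl (Or.inr ⟨i, rfl⟩))
  have h0 : u' * v' = 0 := hφ (by rw [map_mul, hu1, hv1, huv, map_zero])
  have h1 : ψ u' * ψ v' = 0 := by rw [← map_mul, h0, map_zero]
  have unit : ∀ a : A, a ≠ 0 → ∀ (h : a ∈ R) (h' : a⁻¹ ∈ R), χ ⟨a, h⟩ ≠ 0 := by
    intro a ha h h' hc
    have : (⟨a, h⟩ : R) * ⟨_, h'⟩ = 1 := Subtype.ext (mul_inv_cancel₀ ha)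
    have := congrArg χ this
    rw [map_mul, hc, zero_mul, map_one] at this
    exact zero_ne_one this
  rcases mul_eq_zero.mp h1 with h | h
  · have := hu2 i (Algebra.subset_adjoin (Or.inl (Or.inl ⟨i, rfl⟩)))
    rw [h] at this
    exact unit _ hi _ (Algebra.subset_adjoin (Or.inr (by simp))) (by simpa using this.symm)
  · have := hv2 l (Algebra.subset_adjoin (Or.inl (Or.inr ⟨l, rfl⟩)))
    rw [h] at this
    exact unit _ hl _ (Algebra.subset_adjoin (Or.inr (by simp))) (by simpa using this.symm)

theorem isDomain_tensor {k : Type} [Field k] [IsAlgClosed k] (A B : Type) [CommRing A] [IsDomain A]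
    [Algebra k A] [CommRing B] [IsDomain B] [Algebra k B] : IsDomain (A ⊗[k] B) := by
  let φ : A ⊗[k] B →ₐ[k] FractionRing A ⊗[k] B :=
    Algebra.TensorProduct.map (IsScalarTower.toAlgHom k A (FractionRing A)) (AlgHom.id k B)
  have hφ : Function.Injective φ :=
    Module.Flat.rTensor_preserves_injective_linearMap (M := B)
      (IsScalarTower.toAlgHom k A (FractionRing A)).toLinearMap
      (IsFractionRing.injective A (FractionRing A))
  have : NoZeroDivisors (A ⊗[k] B) := ⟨by
    intro a b hab
    by_contra! h
    exact noZeroDivisors_tensor_field (φ a) (φ b) (by rw [← map_mul, hab, map_zero])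
      (by simpa using hφ.ne h.1) (by simpa using hφ.ne h.2)⟩
  have : Nontrivial (A ⊗[k] B) := inferInstance
  exact NoZeroDivisors.to_isDomain _

theorem pi_mul_of_tprod {k : Type} [Field k] {D : Type} [CommRing D] [Algebra k D] {n : ℕ}
    {B : Type} [CommRing B] [Algebra k B] (E : (⨂[k] _ : Fin n, D) →ₗ[k] B)
    (hE : ∀ f g : Fin n → D, E (PiTensorProduct.tprod k (f * g)) =
      E (PiTensorProduct.tprod k f) * E (PiTensorProduct.tprod k g))
    (x y : ⨂[k] _ : Fin n, D) : E (x * y) = E x * E y := by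
  induction x using PiTensorProduct.induction_on with
  | add a b ha hb => rw [add_mul, map_add, ha, hb, map_add, add_mul]
  | smul_tprod r f =>
    induction y using PiTensorProduct.induction_on with
    | add a b ha hb => rw [mul_add, map_add, ha, hb, map_add, mul_add]
    | smul_tprod s g =>
      rw [PiTensorProduct.smul_tprod_mul_smul_tprod, map_smul, hE, map_smul, map_smul,
        smul_mul_smul_comm]

theorem isDomain_pi {k : Type} [Field k] [IsAlgClosed k] (D : Type) [CommRing D] [IsDomain D]
    [Algebra k D] (n : ℕ) : IsDomain (⨂[k] _ : Fin n, D) := by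
  induction n with
  | zero =>
    let E : (⨂[k] _ : Fin 0, D) ≃ₗ[k] k := PiTensorProduct.isEmptyEquiv (Fin 0)
    let F : (⨂[k] _ : Fin 0, D) ≃* k := { E with
      map_mul' := pi_mul_of_tprod E.toLinearMap (by
        intro f g
        simp [E, PiTensorProduct.isEmptyEquiv_apply_tprod]) }
    exact F.isDomain_iff.mpr inferInstance
  | succ n ih =>
    have := isDomain_tensor (k := k) D (⨂[k] _ : Fin n, D)
    let E : (⨂[k] _ : Fin (n+1), D) ≃ₗ[k] D ⊗[k] (⨂[k] _ : Fin n, D) :=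
      (PiTensorProduct.reindex k (fun _ => D)
        ((finCongr (Nat.add_comm n 1)).trans (finSumFinEquiv (m := 1) (n := n)).symm)).trans
        ((PiTensorProduct.tmulEquiv k D).symm.trans
          (TensorProduct.congr (PiTensorProduct.subsingletonEquiv (0 : Fin 1))
            (LinearEquiv.refl k _)))
    let F : (⨂[k] _ : Fin (n+1), D) ≃* D ⊗[k] (⨂[k] _ : Fin n, D) := { E with
      map_mul' := pi_mul_of_tprod E.toLinearMap (by
        intro f g
        simp [E]
        rfl) }
    exact F.isDomain_iff.mpr inferInstance

def IsLC (k : Type) {K : Type} [Field k] [Ring K] [HopfAlgebra k K] (V : Submodule k K) : Prop :=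
  ∀ v ∈ V, Coalgebra.comul (R := k) v ∈ LinearMap.range (LinearMap.lTensor K V.subtype)

theorem IsLC.sup {k K : Type} [Field k] [Ring K] [HopfAlgebra k K] {V W : Submodule k K}
    (hV : IsLC k V) (hW : IsLC k W) : IsLC k (V ⊔ W) := by
  have mono : ∀ (X Y : Submodule k K), X ≤ Y → LinearMap.range (LinearMap.lTensor K X.subtype) ≤
      LinearMap.range (LinearMap.lTensor K Y.subtype) := by
    intro X Y h
    have : X.subtype = Y.subtype ∘ₗ Submodule.inclusion h := rfl
    rw [this, LinearMap.lTensor_comp]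
    exact LinearMap.range_comp_le_range _ _
  intro x hx
  obtain ⟨v, hv, w, hw, rfl⟩ := Submodule.mem_sup.mp hx
  rw [map_add]
  exact add_mem (mono _ _ le_sup_left (hV v hv)) (mono _ _ le_sup_right (hW w hw))

theorem exists_LC {k K : Type} [Field k] [Ring K] [HopfAlgebra k K] (x : K) :
    ∃ V : Submodule k K, V.FG ∧ x ∈ V ∧ IsLC k V := by
  classical
  let b := Module.Basis.ofVectorSpace k K
  obtain ⟨y, hy⟩ := TensorProduct.eq_repr_basis_left b (Coalgebra.comul (R := k) x)
  let V : Submodule k K := Submodule.span k (y '' y.support)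
  have hyV : ∀ i ∈ y.support, y i ∈ V := fun i hi => Submodule.subset_span ⟨i, hi, rfl⟩
  refine ⟨V, ⟨y.support.image y, by simp [V]⟩, ?_, ?_⟩
  · have h := Coalgebra.rTensor_counit_comul (R := k) x
    rw [← hy, Finsupp.sum, map_sum] at h
    have h2 := congrArg (TensorProduct.lid k K) h
    rw [map_sum] at h2
    simp only [LinearMap.rTensor_tmul, TensorProduct.lid_tmul, one_smul] at h2
    rw [← h2]
    exact sum_mem fun i hi => V.smul_mem _ (hyV i hi)
  · have key : ∀ i, i ∈ y.support → Coalgebra.comul (R := k) (y i) ∈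
        LinearMap.range (LinearMap.lTensor K V.subtype) := by
      intro i hi
      let Lf : K ⊗[k] (K ⊗[k] K) →ₗ[k] K ⊗[k] K :=
        (TensorProduct.lid k _).toLinearMap ∘ₗ LinearMap.rTensor _ (b.coord i)
      have hL : ∀ (t : K ⊗[k] K) (z : K), Lf (TensorProduct.assoc k K K K (t ⊗ₜ z)) =
          (TensorProduct.lid k K (LinearMap.rTensor K (b.coord i) t)) ⊗ₜ z := by
        intro t z
        induction t with
        | zero => simp
        | add a c ha hc => simp only [TensorProduct.add_tmul, map_add, ha, hc]
        | tmul a c => simp [Lf, TensorProduct.smul_tmul']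
      have h := congrArg Lf (Coalgebra.coassoc_apply (R := k) x)
      rw [← hy, Finsupp.sum] at h
      simp only [map_sum, LinearMap.rTensor_tmul, LinearMap.lTensor_tmul, hL] at h
      have h3 : ∑ l ∈ y.support, Lf (b l ⊗ₜ Coalgebra.comul (R := k) (y l)) =
          Coalgebra.comul (R := k) (y i) := by
        rw [Finset.sum_eq_single i]
        · simp [Lf]
        · intro j _ hj
          simp [Lf, Finsupp.single_apply, hj]
        · intro h; exact absurd hi h
      rw [h3] at h
      rw [← h]
      refine sum_mem fun l hl => ⟨_ ⊗ₜ ⟨y l, hyV l hl⟩, by rw [LinearMap.lTensor_tmul]; rfl⟩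
    intro v hv
    refine Submodule.span_induction (p := fun v _ => Coalgebra.comul (R := k) v ∈
        LinearMap.range (LinearMap.lTensor K V.subtype)) ?_ ?_ ?_ ?_ hv
    · rintro _ ⟨i, hi, rfl⟩
      exact key i hi
    · simp
    · intro a c _ _ ha hc
      rw [map_add]; exact add_mem ha hc
    · intro r a _ ha
      rw [map_smul]; exact Submodule.smul_mem _ _ ha

theorem exists_comatrix {k K : Type} [Field k] [Ring K] [HopfAlgebra k K] (V : Submodule k K)
    (hV : V.FG) (hLC : IsLC k V) :
    ∃ (d : ℕ) (v : Fin d → K) (φ : Fin d → (K →ₗ[k] k)) (t : Fin d → Fin d → K),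
      (V = Submodule.span k (Set.range v)) ∧
      (∀ i l, φ i (v l) = if i = l then 1 else 0) ∧
      (∀ i, Coalgebra.comul (R := k) (v i) = ∑ l, t i l ⊗ₜ[k] v l) ∧
      (∀ i l, Coalgebra.comul (R := k) (t i l) = ∑ m, t i m ⊗ₜ[k] t m l) ∧
      (∀ i l, Coalgebra.counit (R := k) (t i l) = if i = l then 1 else 0) := by
  classical
  have : Module.Finite k V := Module.Finite.iff_fg.mpr hV
  let b := Module.finBasis k V
  obtain ⟨p, hp⟩ := LinearMap.exists_leftInverse_of_injective V.subtype (by simp)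
  have hp' : ∀ x : V, p x = x := fun x => congrArg (fun f => f x) hp
  have ht : ∀ i, ∃ t : Fin (Module.finrank k V) → K,
      Coalgebra.comul (R := k) (b i : K) = ∑ l, t l ⊗ₜ[k] (b l : K) := by
    intro i
    obtain ⟨w, hw⟩ := hLC (b i) (b i).2
    obtain ⟨c, hc⟩ := TensorProduct.eq_repr_basis_right b w
    refine ⟨c, ?_⟩
    rw [← hw, ← hc, Finsupp.sum_fintype _ _ (by simp), map_sum]
    simp
  choose t ht using ht
  let φ : Fin (Module.finrank k V) → (K →ₗ[k] k) := fun i => b.coord i ∘ₗ p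
  have hφ : ∀ i l, φ i (b l) = if i = l then 1 else 0 := by
    intro i l
    simp [φ, hp', Finsupp.single_apply, eq_comm]
  refine ⟨Module.finrank k V, fun i => (b i : K), φ, t, ?_, hφ, ht, ?_, ?_⟩
  · have := congrArg (Submodule.map V.subtype) b.span_eq
    rw [Submodule.map_span, Submodule.map_top, Submodule.range_subtype, ← Set.range_comp] at this
    exact this.symm
  · intro i l
    have h := Coalgebra.coassoc_apply (R := k) (b i : K)
    rw [ht i] at h
    let L : K ⊗[k] (K ⊗[k] K) →ₗ[k] K ⊗[k] K :=
      LinearMap.lTensor K ((TensorProduct.rid k K).toLinearMap ∘ₗ LinearMap.lTensor K (φ l))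
    have hL : ∀ (s : K ⊗[k] K) (z : K), L (TensorProduct.assoc k K K K (s ⊗ₜ z)) = φ l z • s := by
      intro s z
      induction s with
      | zero => simp
      | add a c ha hc => simp only [TensorProduct.add_tmul, map_add, ha, hc, smul_add]
      | tmul a c => simp [L]
    have h2 := congrArg L h
    simp only [map_sum, LinearMap.rTensor_tmul, LinearMap.lTensor_tmul, hL, hφ, ht] at h2
    simp only [TensorProduct.tmul_sum, map_sum, L, LinearMap.lTensor_tmul, LinearMap.comp_apply, hφ,
      LinearEquiv.coe_coe, TensorProduct.rid_tmul, ite_smul, one_smul, zero_smul] at h2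
    simp only [← TensorProduct.tmul_sum, Finset.sum_ite_eq, Finset.mem_univ, if_true] at h2
    simpa using h2
  · intro i l
    have h := Coalgebra.rTensor_counit_comul (R := k) (b i : K)
    rw [ht i, map_sum] at h
    have h2 := congrArg (fun z => φ l (TensorProduct.lid k K z)) h
    simp only [map_sum, LinearMap.rTensor_tmul, TensorProduct.lid_tmul, map_smul, hφ] at h2
    simpa [eq_comm] using h2

theorem HopfAction.act_mul_sum {k K A : Type} [Field k] [Ring K] [HopfAlgebra k K]
    [CommRing A] [Algebra k A] (ha : HopfAction k K A) {ι : Type*} (s : Finset ι) (h : K)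
    (x y : ι → K) (hc : Coalgebra.comul (R := k) h = ∑ i ∈ s, x i ⊗ₜ[k] y i) (a b : A) :
    ha.act h (a * b) = ∑ i ∈ s, ha.act (x i) a * ha.act (y i) b := by
  rw [ha.act_mul, hc]
  simp [LinearMap.flip_apply]

theorem det_act_ne_zero {k K A : Type} [Field k] [Ring K] [HopfAlgebra k K]
    [CommRing A] [IsDomain A] [Algebra k A] (ha : HopfAction k K A) {d : ℕ}
    (t : Fin d → Fin d → K)
    (ht : ∀ i l, Coalgebra.comul (R := k) (t i l) = ∑ m, t i m ⊗ₜ[k] t m l)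
    (hε : ∀ i l, Coalgebra.counit (R := k) (t i l) = if i = l then 1 else 0)
    (a : A) (ha0 : a ≠ 0) :
    (Matrix.of fun i l => ha.act (t i l) a).det ≠ 0 := by
  classical
  have hS1 : ∀ i l, ∑ m, HopfAlgebra.antipode k (t i m) * t m l = if i = l then 1 else 0 := by
    intro i l
    have := HopfAlgebra.mul_antipode_rTensor_comul_apply (R := k) (t i l)
    rw [ht, hε] at this
    simpa [apply_ite] using this
  have hS2 : ∀ i l, ∑ m, t i m * HopfAlgebra.antipode k (t m l) = if i = l then 1 else 0 := by
    intro i l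
    have := HopfAlgebra.mul_antipode_lTensor_comul_apply (R := k) (t i l)
    rw [ht, hε] at this
    simpa [apply_ite] using this
  intro hdet
  obtain ⟨v, hv0, hv⟩ := Matrix.exists_mulVec_eq_zero_iff.mpr hdet
  apply hv0
  let w : Fin d → A := fun i => ∑ l, ha.act (HopfAlgebra.antipode k (t i l)) (v l)
  have hw : ∀ i, ∑ l, ha.act (t i l) (w l) = v i := by
    intro i
    simp only [w, map_sum]
    rw [Finset.sum_comm]
    have : ∀ m, ∑ l, ha.act (t i l) (ha.act (HopfAlgebra.antipode k (t l m)) (v m)) =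
        if i = m then v m else 0 := by
      intro m
      have := congrArg (fun x => ha.act x (v m)) (hS2 i m)
      simp only [map_sum, map_mul, LinearMap.sum_apply, Module.End.mul_apply] at this
      rw [this]; split_ifs <;> simp
    simp [this]
  have h1 : ∀ i, ∑ l, ha.act (t i l) (a * w l) = 0 := by
    intro i
    have : ∀ l, ha.act (t i l) (a * w l) = ∑ m, ha.act (t i m) a * ha.act (t m l) (w l) :=
      fun l => ha.act_mul_sum _ _ _ _ (ht i l) _ _
    simp only [this]
    rw [Finset.sum_comm]
    simp only [← Finset.mul_sum, hw]
    exact congrFun hv i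
  have h2 : ∀ i, a * w i = 0 := by
    intro i
    have h3 : ∑ m, ha.act (HopfAlgebra.antipode k (t i m)) (∑ l, ha.act (t m l) (a * w l)) = 0 := by
      simp [h1]
    simp only [map_sum] at h3
    rw [Finset.sum_comm] at h3
    have : ∀ m, ∑ l, ha.act (HopfAlgebra.antipode k (t i l)) (ha.act (t l m) (a * w m)) =
        if i = m then a * w m else 0 := by
      intro m
      have := congrArg (fun x => ha.act x (a * w m)) (hS1 i m)
      simp only [map_sum, map_mul, LinearMap.sum_apply, Module.End.mul_apply] at this
      rw [this]; split_ifs <;> simp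
    simpa [this] using h3
  funext i
  rw [← hw i]
  have : ∀ l, w l = 0 := fun l => (mul_eq_zero.mp (h2 l)).resolve_left ha0
  simp [this]

theorem exists_rep {k K Q : Type} [Field k] [Ring K] [HopfAlgebra k K] [CommRing Q] [Algebra k Q]
    (z : Q ⊗[k] K) :
    ∃ (d : ℕ) (v : Fin d → K) (φ : Fin d → (K →ₗ[k] k)) (t : Fin d → Fin d → K) (q : Fin d → Q),
      (∀ i l, φ i (v l) = if i = l then 1 else 0) ∧
      (∀ i, Coalgebra.comul (R := k) (v i) = ∑ l, t i l ⊗ₜ[k] v l) ∧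
      (∀ i l, Coalgebra.comul (R := k) (t i l) = ∑ m, t i m ⊗ₜ[k] t m l) ∧
      (∀ i l, Coalgebra.counit (R := k) (t i l) = if i = l then 1 else 0) ∧
      z = ∑ i, q i ⊗ₜ[k] v i := by
  have h1 : ∃ V : Submodule k K, V.FG ∧ IsLC k V ∧
      z ∈ LinearMap.range (LinearMap.lTensor Q V.subtype) := by
    have mono : ∀ (X Y : Submodule k K), X ≤ Y → LinearMap.range (LinearMap.lTensor Q X.subtype) ≤
        LinearMap.range (LinearMap.lTensor Q Y.subtype) := by
      intro X Y h
      have : X.subtype = Y.subtype ∘ₗ Submodule.inclusion h := rfl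
      rw [this, LinearMap.lTensor_comp]
      exact LinearMap.range_comp_le_range _ _
    induction z with
    | zero => exact ⟨⊥, Submodule.fg_bot, by intro v hv; simp_all, zero_mem _⟩
    | tmul q x =>
      obtain ⟨V, h1, h2, h3⟩ := exists_LC (k := k) x
      exact ⟨V, h1, h3, ⟨q ⊗ₜ ⟨x, h2⟩, by simp⟩⟩
    | add a b ha hb =>
      obtain ⟨V, h1, h2, h3⟩ := ha
      obtain ⟨W, g1, g2, g3⟩ := hb
      exact ⟨V ⊔ W, h1.sup g1, h2.sup g2, add_mem (mono _ _ le_sup_left h3)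
        (mono _ _ le_sup_right g3)⟩
  obtain ⟨V, hV, hLC, w, rfl⟩ := h1
  obtain ⟨d, v, φ, t, hs, hφ, hv, ht, hε⟩ := exists_comatrix V hV hLC
  have h2 : ∃ q : Fin d → Q, LinearMap.lTensor Q V.subtype w = ∑ i, q i ⊗ₜ[k] v i := by
    induction w with
    | zero => exact ⟨0, by simp⟩
    | tmul q x =>
      have hx : (x : K) ∈ Submodule.span k (Set.range v) := hs.le x.2
      obtain ⟨c, hc⟩ := (Submodule.mem_span_range_iff_exists_fun k).mp hx
      refine ⟨fun i => c i • q, ?_⟩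
      rw [LinearMap.lTensor_tmul, Submodule.subtype_apply]
      conv_lhs => rw [← hc]
      simp [TensorProduct.tmul_sum, TensorProduct.smul_tmul]
    | add a b ha hb =>
      obtain ⟨q, hq⟩ := ha
      obtain ⟨r, hr⟩ := hb
      exact ⟨q + r, by simp [hq, hr, TensorProduct.add_tmul, Finset.sum_add_distrib]⟩
  obtain ⟨q, hq⟩ := h2
  exact ⟨d, v, φ, t, q, hφ, hv, ht, hε, hq⟩

theorem conv_isUnit {k K Q : Type} [Field k] [Ring K] [HopfAlgebra k K] [Field Q] [Algebra k Q]
    (α : K →ₗ[k] Q)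
    (hα : ∀ (d : ℕ) (t : Fin d → Fin d → K),
      (∀ i l, Coalgebra.comul (R := k) (t i l) = ∑ m, t i m ⊗ₜ[k] t m l) →
      (∀ i l, Coalgebra.counit (R := k) (t i l) = if i = l then 1 else 0) →
      (Matrix.of fun i l => α (t i l)).det ≠ 0) :
    IsUnit (WithConv.toConv α) := by
  classical
  let N : Q ⊗[k] K →ₗ[Q] Q ⊗[k] K :=
    LinearMap.liftBaseChange Q (LinearMap.rTensor K α ∘ₗ Coalgebra.comul)
  have hN : ∀ {d : ℕ} (v : Fin d → K) (t : Fin d → Fin d → K) (q : Fin d → Q)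
      (hv : ∀ i, Coalgebra.comul (R := k) (v i) = ∑ l, t i l ⊗ₜ[k] v l),
      N (∑ i, q i ⊗ₜ[k] v i) =
        ∑ l, (Matrix.vecMul q (Matrix.of fun i l => α (t i l)) l) ⊗ₜ[k] v l := by
    intro d v t q hv
    simp only [N, map_sum, LinearMap.liftBaseChange_tmul, LinearMap.comp_apply, hv,
      LinearMap.rTensor_tmul, Finset.smul_sum, Matrix.vecMul, dotProduct, Matrix.of_apply,
      TensorProduct.sum_tmul, TensorProduct.smul_tmul', smul_eq_mul]
    rw [Finset.sum_comm]
  have hsurj : Function.Surjective N := by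
    intro z
    obtain ⟨d, v, φ, t, q, hφ, hv, ht, hε, rfl⟩ := exists_rep z
    have hdet := hα d t ht hε
    refine ⟨∑ i, (Matrix.vecMul q (Matrix.of fun i l => α (t i l))⁻¹ i) ⊗ₜ[k] v i, ?_⟩
    rw [hN v t _ hv, Matrix.vecMul_vecMul, Matrix.nonsing_inv_mul _ hdet.isUnit, Matrix.vecMul_one]
  have hinj : Function.Injective N := by
    rw [injective_iff_map_eq_zero]
    intro z hz
    obtain ⟨d, v, φ, t, q, hφ, hv, ht, hε, rfl⟩ := exists_rep z
    have hdet := hα d t ht hε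
    rw [hN v t _ hv] at hz
    have : q = 0 := by
      apply Matrix.eq_zero_of_vecMul_eq_zero hdet
      funext l
      have := congrArg (fun z => TensorProduct.rid k Q (LinearMap.lTensor Q (φ l) z)) hz
      simp only [map_sum, LinearMap.lTensor_tmul, hφ, TensorProduct.rid_tmul, map_zero] at this
      simpa using this
    simp [this]
  let e := LinearEquiv.ofBijective N ⟨hinj, hsurj⟩
  have hconv : ∀ (f : K →ₗ[k] Q) (x : K), LinearMap.liftBaseChange Q f (N (1 ⊗ₜ x)) =
      (WithConv.toConv α * WithConv.toConv f) x := by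
    intro f x
    rw [LinearMap.convMul_apply]
    simp only [N, LinearMap.liftBaseChange_tmul, one_smul, LinearMap.comp_apply]
    generalize (Coalgebra.comul (R := k) x) = c
    induction c with
    | zero => simp
    | add a b ha hb => simp only [map_add, ha, hb]
    | tmul a b => simp
  let ε : K →ₗ[k] Q := Algebra.linearMap k Q ∘ₗ Coalgebra.counit
  let g : K →ₗ[k] Q := (LinearMap.liftBaseChange Q ε ∘ₗ e.symm.toLinearMap).restrictScalars k ∘ₗ
    TensorProduct.mk k Q K 1
  have hgl : LinearMap.liftBaseChange Q g = LinearMap.liftBaseChange Q ε ∘ₗ e.symm.toLinearMap := by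
    apply TensorProduct.AlgebraTensorModule.ext
    intro q x
    simp only [LinearMap.liftBaseChange_tmul, g]
    rw [show q ⊗ₜ[k] x = q • ((1 : Q) ⊗ₜ[k] x) by simp [TensorProduct.smul_tmul'], map_smul]
    simp
  have hr : WithConv.toConv α * WithConv.toConv g = 1 := by
    ext x
    rw [← hconv, hgl]
    have : e.symm (N (1 ⊗ₜ x)) = 1 ⊗ₜ x := e.symm_apply_apply _
    simp [this, ε]
  have hcancel : ∀ f f' : WithConv (K →ₗ[k] Q), WithConv.toConv α * f = WithConv.toConv α * f' →
      f = f' := by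
    intro f f' h
    have h1 : LinearMap.liftBaseChange Q f.ofConv ∘ₗ N =
        LinearMap.liftBaseChange Q f'.ofConv ∘ₗ N := by
      apply TensorProduct.AlgebraTensorModule.ext
      intro q x
      rw [show q ⊗ₜ[k] x = q • ((1 : Q) ⊗ₜ[k] x) by simp [TensorProduct.smul_tmul'], map_smul,
        map_smul, LinearMap.comp_apply, LinearMap.comp_apply, hconv, hconv]
      congr 1
      exact congrArg (fun z : WithConv (K →ₗ[k] Q) => z x) h
    have h2 : LinearMap.liftBaseChange Q f.ofConv = LinearMap.liftBaseChange Q f'.ofConv :=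
      LinearMap.ext fun z => by
        obtain ⟨y, rfl⟩ := hsurj z
        exact DFunLike.congr_fun h1 y
    ext x
    have := DFunLike.congr_fun h2 (1 ⊗ₜ x)
    simpa using this
  have hl : WithConv.toConv g * WithConv.toConv α = 1 := by
    apply hcancel
    rw [← mul_assoc, hr, one_mul, mul_one]
  exact ⟨⟨_, _, hr, hl⟩, rfl⟩

theorem fractionRing_ringHom_ext {A T : Type} [CommRing A] [IsDomain A] [Ring T]
    (r1 r2 : FractionRing A →+* T)
    (h : ∀ a, r1 (algebraMap A _ a) = r2 (algebraMap A _ a)) (q : FractionRing A) :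
    r1 q = r2 q := by
  obtain ⟨⟨n, d⟩, hq⟩ := IsLocalization.surj (nonZeroDivisors A) q
  have hu : IsUnit (r1 (algebraMap A (FractionRing A) d)) :=
    (IsLocalization.map_units (FractionRing A) d).map r1
  apply hu.mul_right_cancel
  rw [← map_mul, h d, ← map_mul, hq]
  exact h n

theorem HopfAction.extend {k K A : Type} [Field k] [Ring K] [HopfAlgebra k K]
    [CommRing A] [IsDomain A] [Algebra k A] (ha : HopfAction k K A) :
    ∃ ha' : HopfAction k K (FractionRing A), ∀ h a,
      ha'.act h (algebraMap A _ a) = algebraMap A _ (ha.act h a) := by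
  classical
  let ι : A →ₗ[k] FractionRing A := (IsScalarTower.toAlgHom k A (FractionRing A)).toLinearMap
  have hι : ∀ a, ι a = algebraMap A _ a := fun a => rfl
  let f0 : A →ₗ[k] (K →ₗ[k] FractionRing A) := (LinearMap.compRight k ι) ∘ₗ
    (ha.act.toLinearMap : K →ₗ[k] A →ₗ[k] A).flip
  have hf0 : ∀ a h, f0 a h = algebraMap A _ (ha.act h a) := fun a h => rfl
  let f : A →+* WithConv (K →ₗ[k] FractionRing A) :=
    { toFun := fun a => WithConv.toConv (f0 a)
      map_one' := by
        ext h
        simp only [LinearMap.convOne_apply]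
        change f0 1 h = _
        rw [hf0, ha.act_one, Algebra.smul_def, mul_one, ← IsScalarTower.algebraMap_apply]
      map_zero' := by simp
      map_add' := by intros; simp
      map_mul' := by
        intro a b
        ext h
        rw [(Coalgebra.Repr.arbitrary k h).convMul_apply]
        change f0 (a * b) h = ∑ i ∈ _, f0 a _ * f0 b _
        rw [hf0, ha.act_mul_sum _ _ _ _ (Coalgebra.Repr.arbitrary k h).eq.symm]
        simp [hf0] }
  have hunit : ∀ s : nonZeroDivisors A, IsUnit (f s) := by
    intro s
    apply conv_isUnit
    intro d t ht hε
    have := det_act_ne_zero ha t ht hε s (nonZeroDivisors.coe_ne_zero s)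
    have h2 : (Matrix.of fun i l => f0 (s : A) (t i l)) =
        (algebraMap A (FractionRing A)).mapMatrix (Matrix.of fun i l => ha.act (t i l) (s : A)) := by
      ext; rfl
    rw [h2, ← RingHom.map_det]
    simpa using this
  let fS : nonZeroDivisors A →* (WithConv (K →ₗ[k] FractionRing A))ˣ :=
    IsUnit.liftRight (f.toMonoidHom.comp (nonZeroDivisors A).subtype) hunit
  let β : FractionRing A →+* WithConv (K →ₗ[k] FractionRing A) :=
    OreLocalization.universalHom f fS (fun s => by
      exact (IsUnit.coe_liftRight (f.toMonoidHom.comp (nonZeroDivisors A).subtype) hunit s).symm)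
  have hβ : ∀ a, β (algebraMap A _ a) = f a := fun a => OreLocalization.universalHom_commutes f fS _
  have hβk : ∀ (c : k) q, β (c • q) = c • β q := by
    intro c q
    have : β (algebraMap k _ c) = c • 1 := by
      rw [IsScalarTower.algebraMap_apply k A (FractionRing A), hβ, Algebra.algebraMap_eq_smul_one,
        ← map_one f]
      change WithConv.toConv (f0 (c • 1)) = _
      rw [map_smul]; rfl
    rw [Algebra.smul_def, map_mul, this, smul_mul_assoc, one_mul]
  let B : FractionRing A →ₗ[k] (K →ₗ[k] FractionRing A) :=
    { toFun := fun q => (β q).ofConv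
      map_add' := by intros; simp
      map_smul' := by intro c q; rw [hβk]; rfl }
  have hBβ : ∀ q h, B q h = β q h := fun q h => rfl
  have hBmul : ∀ (h : K) (q q' : FractionRing A), B (q * q') h =
      ∑ i ∈ (Coalgebra.Repr.arbitrary k h).index, B q ((Coalgebra.Repr.arbitrary k h).left i) *
        B q' ((Coalgebra.Repr.arbitrary k h).right i) := by
    intro h q q'
    rw [hBβ, map_mul, (Coalgebra.Repr.arbitrary k h).convMul_apply]
    rfl
  have hBone : ∀ h : K, B 1 h = algebraMap k _ (Coalgebra.counit (R := k) h) := by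
    intro h
    rw [hBβ, map_one, LinearMap.convOne_apply]
  have hBι : ∀ a h, B (algebraMap A _ a) h = algebraMap A _ (ha.act h a) := by
    intro a h
    rw [hBβ, hβ]; rfl
  have hB1 : ∀ q, B q 1 = q := by
    let r : FractionRing A →+* FractionRing A :=
      { toFun := fun q => B q 1
        map_one' := by simp [hBone]
        map_zero' := by simp
        map_add' := by intros; simp
        map_mul' := by
          intro q q'
          rw [hBβ, map_mul, LinearMap.convMul_apply]
          simp [Algebra.TensorProduct.one_def]
          rfl }
    intro q
    exact fractionRing_ringHom_ext r (RingHom.id _) (fun a => by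
      change B (algebraMap A _ a) 1 = (algebraMap A _ a); rw [hBι]; simp) q
  have hBm : ∀ h h' q, B q (h * h') = B (B q h') h := by
    let r1 : FractionRing A →+* WithConv (K ⊗[k] K →ₗ[k] FractionRing A) :=
      { toFun := fun q => WithConv.toConv ((β q).ofConv.comp
          (Bialgebra.mulCoalgHom k K).toLinearMap)
        map_one' := by
          rw [map_one]
          apply WithConv.ofConv_injective
          apply LinearMap.ext
          intro z
          change (1 : WithConv (K →ₗ[k] FractionRing A)) (Bialgebra.mulCoalgHom k K z) =
            (1 : WithConv (K ⊗[k] K →ₗ[k] FractionRing A)) z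
          rw [LinearMap.convOne_apply, LinearMap.convOne_apply]
          congr 1
          exact CoalgHomClass.counit_comp_apply (Bialgebra.mulCoalgHom k K) z
        map_zero' := by rw [map_zero]; rfl
        map_add' := by intros; rw [map_add]; rfl
        map_mul' := by
          intro q q'
          rw [map_mul, LinearMap.convMul_comp_coalgHom_distrib] }
    let g : FractionRing A → (K ⊗[k] K →ₗ[k] FractionRing A) := fun q =>
      TensorProduct.lift ((LinearMap.lcomp k (FractionRing A) (B q)) ∘ₗ B.flip)
    have hg : ∀ q h h', g q (h ⊗ₜ h') = B (B q h') h := fun q h h' => rfl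
    let r2 : FractionRing A →+* WithConv (K ⊗[k] K →ₗ[k] FractionRing A) :=
      { toFun := fun q => WithConv.toConv (g q)
        map_one' := by
          apply WithConv.ofConv_injective
          apply TensorProduct.ext'
          intro h h'
          change g 1 (h ⊗ₜ h') = (1 : WithConv (K ⊗[k] K →ₗ[k] FractionRing A)) (h ⊗ₜ h')
          rw [hg, LinearMap.convOne_apply, hBone, Algebra.algebraMap_eq_smul_one, map_smul,
            LinearMap.smul_apply, hBone]
          simp [Algebra.smul_def, mul_comm]
        map_zero' := by
          apply WithConv.ofConv_injective
          apply TensorProduct.ext'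
          intro h h'
          change g 0 (h ⊗ₜ h') = 0
          simp [hg]
        map_add' := by
          intro q q'
          apply WithConv.ofConv_injective
          apply TensorProduct.ext'
          intro h h'
          change g _ (h ⊗ₜ h') = g _ (h ⊗ₜ h') + g _ (h ⊗ₜ h')
          simp [hg]
        map_mul' := by
          intro q q'
          apply WithConv.ofConv_injective
          apply TensorProduct.ext'
          intro h h'
          change g (q * q') (h ⊗ₜ h') = (WithConv.toConv (g q) * WithConv.toConv (g q')) (h ⊗ₜ h')
          rw [((Coalgebra.Repr.arbitrary k h).tmul
            (Coalgebra.Repr.arbitrary k h')).convMul_apply, hg, hBmul, map_sum, LinearMap.sum_apply]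
          simp only [hBmul h]
          rw [Coalgebra.Repr.tmul_index, Finset.sum_product_right]
          rfl }
    intro h h' q
    have := fractionRing_ringHom_ext r1 r2 (fun a => by
      apply WithConv.ofConv_injective
      apply TensorProduct.ext'
      intro h h'
      change B (algebraMap A _ a) (h * h') = g (algebraMap A _ a) (h ⊗ₜ h')
      rw [hg]
      simp [hBι]) q
    exact congrArg (fun z : WithConv (K ⊗[k] K →ₗ[k] FractionRing A) => z (h ⊗ₜ h')) this
  refine ⟨⟨AlgHom.ofLinearMap B.flip ?_ ?_, ?_, ?_⟩, ?_⟩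
  · ext q; exact hB1 q
  · intro h h'; ext q; exact hBm h h' q
  · intro h a b
    change B (a * b) h = _
    rw [hBβ, map_mul, LinearMap.convMul_apply]
    rfl
  · intro h
    change B 1 h = _
    rw [hBone, Algebra.smul_def, mul_one]
  · intro h a
    exact hBι a h

section SP
variable {k H K : Type} [Field k] [Ring H] [HopfAlgebra k H] [Ring K] [HopfAlgebra k K] {n : ℕ}
  {π : Equiv.Perm (Fin n) →* K} {j : Fin n → (H →ₐ[k] K)}

noncomputable def IsSmashProductPerm.P (hK : IsSmashProductPerm k H K n π j) : (Fin n → H) →* K :=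
  MonoidHom.noncommPiCoprod (fun i => ((j i : H →* K)))
    (fun i i' hi x y => hK.commute_j i i' hi x y)

theorem IsSmashProductPerm.P_mulSingle (hK : IsSmashProductPerm k H K n π j) (l : Fin n) (h : H) :
    hK.P (Pi.mulSingle l h) = j l h :=
  MonoidHom.noncommPiCoprod_mulSingle _ _ _

theorem IsSmashProductPerm.P_eq (hK : IsSmashProductPerm k H K n π j) (h : Fin n → H) :
    hK.P h = (List.ofFn fun i => j i (h i)).prod := by
  rw [List.ofFn_eq_map, ← Finset.noncommProd_toFinset (List.finRange n) (fun i => j i (h i))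
    (fun i _ i' _ hi => hK.commute_j i i' hi _ _) (List.nodup_finRange n)]
  simp only [List.toFinset_finRange]
  rfl

theorem IsSmashProductPerm.P_conj (hK : IsSmashProductPerm k H K n π j) (τ : Equiv.Perm (Fin n))
    (g : Fin n → H) : hK.P g * π τ = π τ * hK.P (g ∘ τ) := by
  have hinv : π τ * π τ⁻¹ = 1 := by rw [← map_mul]; simp
  have hinv' : π τ⁻¹ * π τ = 1 := by rw [← map_mul]; simp
  let f1 : (Fin n → H) →* K :=
    { toFun := fun g => π τ * hK.P (g ∘ τ) * π τ⁻¹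
      map_one' := by
        have : (1 : Fin n → H) ∘ τ = 1 := rfl
        rw [this, map_one, mul_one, hinv]
      map_mul' := by
        intro a b
        have : (a * b) ∘ τ = (a ∘ τ) * (b ∘ τ) := rfl
        rw [this, map_mul]
        calc _ = π τ * hK.P (a ∘ τ) * 1 * hK.P (b ∘ τ) * π τ⁻¹ := by simp only [mul_assoc, one_mul]
          _ = _ := by rw [← hinv']; simp only [mul_assoc] }
  have : f1 = hK.P := by
    apply MonoidHom.pi_ext
    intro i x
    have h1 : (Pi.mulSingle i x : Fin n → H) ∘ τ = Pi.mulSingle (τ⁻¹ i) x := by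
      funext l
      simp only [Function.comp_apply, Pi.mulSingle_apply, Equiv.Perm.eq_inv_iff_eq]
    change π τ * hK.P ((Pi.mulSingle i x : Fin n → H) ∘ τ) * π τ⁻¹ = _
    rw [h1, hK.P_mulSingle, hK.P_mulSingle, hK.conj, mul_assoc, hinv]
    simp
  conv_lhs => rw [← this]
  change π τ * hK.P (g ∘ τ) * π τ⁻¹ * π τ = _
  rw [mul_assoc, hinv', mul_one]

noncomputable def IsSmashProductPerm.m (hK : IsSmashProductPerm k H K n π j)
    (σ : Equiv.Perm (Fin n)) (h : Fin n → H) : K := π σ * hK.P h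

theorem IsSmashProductPerm.m_mul (hK : IsSmashProductPerm k H K n π j)
    (σ τ : Equiv.Perm (Fin n)) (g g' : Fin n → H) :
    hK.m σ g * hK.m τ g' = hK.m (σ * τ) ((g ∘ τ) * g') := by
  simp only [IsSmashProductPerm.m, map_mul]
  rw [mul_assoc, ← mul_assoc (hK.P g), hK.P_conj]
  simp only [mul_assoc]

theorem IsSmashProductPerm.m_one (hK : IsSmashProductPerm k H K n π j)
    (σ : Equiv.Perm (Fin n)) : hK.m σ 1 = π σ := by simp [IsSmashProductPerm.m]

theorem IsSmashProductPerm.m_single (hK : IsSmashProductPerm k H K n π j)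
    (l : Fin n) (h : H) : hK.m 1 (Pi.mulSingle l h) = j l h := by
  simp [IsSmashProductPerm.m, hK.P_mulSingle]

theorem IsSmashProductPerm.m_mul_j (hK : IsSmashProductPerm k H K n π j)
    (σ : Equiv.Perm (Fin n)) (g : Fin n → H) (l : Fin n) (h : H) :
    hK.m σ g * j l h = hK.m σ (g * Pi.mulSingle l h) := by
  rw [← hK.m_single, hK.m_mul]; simp

theorem IsSmashProductPerm.map_eq (hK : IsSmashProductPerm k H K n π j)
    (σ : Equiv.Perm (Fin n)) (h : Fin n → H) :
    smashProductMap n π j (Finsupp.single σ 1 ⊗ₜ PiTensorProduct.tprod k h) = hK.m σ h := by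
  simp [smashProductMap, IsSmashProductPerm.m, hK.P_eq]

theorem IsSmashProductPerm.exists_lin (hK : IsSmashProductPerm k H K n π j) {E : Type}
    [AddCommGroup E] [Module k E] (F : Equiv.Perm (Fin n) → MultilinearMap k (fun _ : Fin n => H) E) :
    ∃ T : K →ₗ[k] E, ∀ σ h, T (hK.m σ h) = F σ h := by
  let e := LinearEquiv.ofBijective (smashProductMap n π j) hK.bij
  let G : ((Equiv.Perm (Fin n) →₀ k) ⊗[k] (⨂[k] _i : Fin n, H)) →ₗ[k] E :=
    TensorProduct.lift (Finsupp.lsum k fun σ : Equiv.Perm (Fin n) =>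
      LinearMap.toSpanSingleton k _ (PiTensorProduct.lift (F σ)))
  refine ⟨G ∘ₗ e.symm.toLinearMap, fun σ h => ?_⟩
  have : e.symm (hK.m σ h) = Finsupp.single σ 1 ⊗ₜ PiTensorProduct.tprod k h := by
    rw [LinearEquiv.symm_apply_eq]
    exact (hK.map_eq σ h).symm
  simp [this, G]

theorem IsSmashProductPerm.lin_ext (hK : IsSmashProductPerm k H K n π j) {E : Type}
    [AddCommGroup E] [Module k E] (f g : K →ₗ[k] E) (hfg : ∀ σ h, f (hK.m σ h) = g (hK.m σ h)) :
    f = g := by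
  have : f ∘ₗ smashProductMap n π j = g ∘ₗ smashProductMap n π j := by
    ext σ h
    simpa [hK.map_eq] using hfg σ h
  ext x
  obtain ⟨z, rfl⟩ := hK.bij.2 x
  exact DFunLike.congr_fun this z

theorem IsSmashProductPerm.span (hK : IsSmashProductPerm k H K n π j) (x : K) :
    x ∈ Submodule.span k (Set.range fun p : Equiv.Perm (Fin n) × (Fin n → H) => hK.m p.1 p.2) := by
  have := hK.lin_ext (Submodule.mkQ (Submodule.span k
    (Set.range fun p : Equiv.Perm (Fin n) × (Fin n → H) => hK.m p.1 p.2))) 0 (fun σ h => by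
      simp only [Submodule.mkQ_apply, LinearMap.zero_apply, Submodule.Quotient.mk_eq_zero]
      exact Submodule.subset_span ⟨(σ, h), rfl⟩)
  have h2 := DFunLike.congr_fun this x
  simpa only [Submodule.mkQ_apply, LinearMap.zero_apply, Submodule.Quotient.mk_eq_zero] using h2

theorem IsSmashProductPerm.ind_m (hK : IsSmashProductPerm k H K n π j) {p : K → Prop}
    (hm : ∀ σ h, p (hK.m σ h)) (hadd : ∀ x y, p x → p y → p (x + y))
    (hsmul : ∀ (c : k) x, p x → p (c • x)) (x : K) : p x := by
  refine Submodule.span_induction (p := fun x _ => p x) ?_ ?_ ?_ ?_ (hK.span x)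
  · rintro _ ⟨⟨σ, h⟩, rfl⟩
    exact hm σ h
  · have := hsmul 0 _ (hm 1 1)
    simpa using this
  · intro x y _ _ hx hy; exact hadd x y hx hy
  · intro c x _ hx; exact hsmul c x hx

theorem list_right_ind {M : Type} [Monoid M] {p : M → Prop} (l : List M)
    (x : M) (hx : p x) (hl : ∀ y ∈ l, ∀ x, p x → p (x * y)) : p (x * l.prod) := by
  induction l generalizing x with
  | nil => simpa using hx
  | cons a t ih =>
    rw [List.prod_cons, ← mul_assoc]
    exact ih _ (hl a (by simp) x hx) (fun y hy => hl y (by simp [hy]))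

theorem IsSmashProductPerm.ind (hK : IsSmashProductPerm k H K n π j) {p : K → Prop}
    (hπ : ∀ σ, p (π σ)) (hj : ∀ x l h, p x → p (x * j l h))
    (hadd : ∀ x y, p x → p y → p (x + y))
    (hsmul : ∀ (c : k) x, p x → p (c • x)) (x : K) : p x := by
  refine hK.ind_m (fun σ h => ?_) hadd hsmul x
  rw [IsSmashProductPerm.m, hK.P_eq]
  apply list_right_ind _ _ (hπ σ)
  intro y hy x hx
  obtain ⟨i, rfl⟩ := (List.mem_ofFn' _ _).mp hy
  exact hj _ _ _ hx

theorem IsSmashProductPerm.counit_π (hK : IsSmashProductPerm k H K n π j) (σ) :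
    Coalgebra.counit (R := k) (π σ) = 1 := by
  have h := Coalgebra.rTensor_counit_comul (R := k) (π σ)
  rw [(hK.grouplike σ).2, LinearMap.rTensor_tmul] at h
  have h2 := congrArg (TensorProduct.lid k K) h
  simp only [TensorProduct.lid_tmul, one_smul] at h2
  have h3 : (Coalgebra.counit (R := k) (π σ) - 1) • π σ = 0 := by
    rw [sub_smul, h2, one_smul, sub_self]
  exact sub_eq_zero.mp ((smul_eq_zero.mp h3).resolve_right (hK.grouplike σ).1)

end SP

theorem HopfAction.tensorPoly {k H L : Type} [Field k] [Ring H] [HopfAlgebra k H] [CommRing L]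
    [Algebra k L] (R : Type) [CommRing R] [Algebra k R] (ha : HopfAction k H L) :
    ∃ hd : HopfAction k H (L ⊗[k] R), ∀ h l p, hd.act h (l ⊗ₜ p) = ha.act h l ⊗ₜ p := by
  let ψ : H →ₐ[k] Module.End k (L ⊗[k] R) := (Module.End.rTensorAlgHom k L R).comp ha.act
  have hψ : ∀ h l p, ψ h (l ⊗ₜ p) = ha.act h l ⊗ₜ p := fun h l p => rfl
  refine ⟨⟨ψ, ?_, ?_⟩, hψ⟩
  · intro h a b
    induction a with
    | zero => simp
    | add a a' h1 h2 => simp only [add_mul, map_add, h1, h2, TensorProduct.map_add_left,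
        LinearMap.add_apply]
    | tmul l p =>
      induction b with
      | zero => simp
      | add a a' h1 h2 => simp only [mul_add, map_add, h1, h2, TensorProduct.map_add_right,
          LinearMap.add_apply]
      | tmul l' p' =>
        rw [Algebra.TensorProduct.tmul_mul_tmul, hψ,
          ha.act_mul_sum _ _ _ _ (Coalgebra.Repr.arbitrary k h).eq.symm,
          ← (Coalgebra.Repr.arbitrary k h).eq]
        simp [hψ, TensorProduct.sum_tmul]
  · intro h
    rw [Algebra.TensorProduct.one_def, hψ, ha.act_one, TensorProduct.smul_tmul']

section SP
variable {k H K : Type} [Field k] [Ring H] [HopfAlgebra k H] [Ring K] [HopfAlgebra k K] {n : ℕ}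
  {π : Equiv.Perm (Fin n) →* K} {j : Fin n → (H →ₐ[k] K)}

theorem IsSmashProductPerm.exists_action (hK : IsSmashProductPerm k H K n π j) {D : Type}
    [CommRing D] [Algebra k D] (hd : HopfAction k H D) :
    ∃ ha : HopfAction k K (⨂[k] _i : Fin n, D), ∀ σ h (a : Fin n → D),
      ha.act (hK.m σ h) (PiTensorProduct.tprod k a) =
        PiTensorProduct.tprod k (fun i => hd.act (h (σ⁻¹ i)) (a (σ⁻¹ i))) := by
  classical
  obtain ⟨T, hT⟩ := hK.exists_lin (E := (⨂[k] _i : Fin n, D) →ₗ[k] (⨂[k] _i : Fin n, D))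
    (fun σ => (LinearMap.compRight k
        (PiTensorProduct.reindex k (fun _ : Fin n => D) σ).toLinearMap).compMultilinearMap
      ((PiTensorProduct.mapMultilinear k (fun _ : Fin n => D) (fun _ : Fin n => D)).compLinearMap
        (fun _ => hd.act.toLinearMap)))
  have hTt : ∀ σ h (a : Fin n → D), T (hK.m σ h) (PiTensorProduct.tprod k a) =
        PiTensorProduct.tprod k (fun i => hd.act (h (σ⁻¹ i)) (a (σ⁻¹ i))) := by
    intro σ h a
    rw [hT]
    change PiTensorProduct.reindex k (fun _ : Fin n => D) σ
      (PiTensorProduct.map (fun i => hd.act (h i)) (PiTensorProduct.tprod k a)) = _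
    rw [PiTensorProduct.map_tprod, PiTensorProduct.reindex_tprod]
    rfl
  have hTmul : ∀ x y, T (x * y) = T x ∘ₗ T y := by
    intro x y
    refine hK.ind_m (p := fun x => T (x * y) = T x ∘ₗ T y) ?_ ?_ ?_ x
    · intro σ g
      refine hK.ind_m (p := fun y => T (hK.m σ g * y) = T (hK.m σ g) ∘ₗ T y) ?_ ?_ ?_ y
      · intro τ g'
        apply PiTensorProduct.ext
        apply MultilinearMap.ext
        intro a
        change T _ (PiTensorProduct.tprod k a) = T _ (T _ (PiTensorProduct.tprod k a))
        rw [hK.m_mul, hTt, hTt, hTt]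
        congr 1
        funext i
        change hd.act (g (τ (τ⁻¹ (σ⁻¹ i))) * g' (τ⁻¹ (σ⁻¹ i))) (a (τ⁻¹ (σ⁻¹ i))) = _
        rw [show τ (τ⁻¹ (σ⁻¹ i)) = σ⁻¹ i from τ.apply_symm_apply _, map_mul]
        rfl
      · intro x y hx hy
        rw [mul_add, map_add, map_add, hx, hy, LinearMap.comp_add]
      · intro c x hx
        rw [mul_smul_comm, map_smul, map_smul, hx, LinearMap.comp_smul]
    · intro x y hx hy
      rw [add_mul, map_add, map_add, hx, hy, LinearMap.add_comp]
    · intro c x hx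
      rw [smul_mul_assoc, map_smul, map_smul, hx, LinearMap.smul_comp]
  have hTπ : ∀ σ (a : Fin n → D), T (π σ) (PiTensorProduct.tprod k a) =
      PiTensorProduct.tprod k (fun i => a (σ⁻¹ i)) := by
    intro σ a
    rw [← hK.m_one, hTt]
    simp
  have hTj : ∀ l h (a : Fin n → D), T (j l h) (PiTensorProduct.tprod k a) =
      PiTensorProduct.tprod k (Function.update a l (hd.act h (a l))) := by
    intro l h a
    rw [← hK.m_single, hTt]
    congr 1
    funext i
    change hd.act ((Pi.mulSingle l h : Fin n → H) i) (a i) = _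
    by_cases hi : i = l
    · subst hi; simp
    · simp [hi]
  have hT1 : T 1 = LinearMap.id := by
    apply PiTensorProduct.ext
    apply MultilinearMap.ext
    intro a
    change T _ (PiTensorProduct.tprod k a) = PiTensorProduct.tprod k a
    rw [← map_one π, hTπ]
    rfl
  have hred : ∀ x : K, (∀ a b : Fin n → D,
      T x (PiTensorProduct.tprod k a * PiTensorProduct.tprod k b) =
        LinearMap.mul' k _ (TensorProduct.map (T.flip (PiTensorProduct.tprod k a))
          (T.flip (PiTensorProduct.tprod k b)) (Coalgebra.comul (R := k) x))) →
      ∀ a b, T x (a * b) = LinearMap.mul' k _ (TensorProduct.map (T.flip a)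
          (T.flip b) (Coalgebra.comul (R := k) x)) := by
    intro x h a b
    induction a using PiTensorProduct.induction_on with
    | add a a' h1 h2 => simp only [add_mul, map_add, h1, h2, TensorProduct.map_add_left,
        LinearMap.add_apply]
    | smul_tprod c a =>
      simp only [smul_mul_assoc, map_smul, TensorProduct.map_smul_left, LinearMap.smul_apply]
      congr 1
      induction b using PiTensorProduct.induction_on with
      | add a a' h1 h2 => simp only [mul_add, map_add, h1, h2, TensorProduct.map_add_right,
        LinearMap.add_apply]
      | smul_tprod c b =>
        simp only [mul_smul_comm, map_smul, TensorProduct.map_smul_right, LinearMap.smul_apply, h]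
  have hmul : ∀ x a b, T x (a * b) = LinearMap.mul' k _ (TensorProduct.map (T.flip a)
          (T.flip b) (Coalgebra.comul (R := k) x)) := by
    intro x
    refine hK.ind (p := fun x => ∀ a b, T x (a * b) = LinearMap.mul' k _
      (TensorProduct.map (T.flip a) (T.flip b) (Coalgebra.comul (R := k) x))) ?_ ?_ ?_ ?_ x
    · intro σ
      apply hred
      intro a b
      rw [(hK.grouplike σ).2, PiTensorProduct.tprod_mul_tprod, TensorProduct.map_tmul,
        LinearMap.mul'_apply, LinearMap.flip_apply, LinearMap.flip_apply, hTπ, hTπ, hTπ,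
        PiTensorProduct.tprod_mul_tprod]
      rfl
    · intro x l h hx
      have hj : ∀ a b, T (j l h) (a * b) = LinearMap.mul' k _
          (TensorProduct.map (T.flip a) (T.flip b) (Coalgebra.comul (R := k) (j l h))) := by
        apply hred
        intro a b
        rw [hK.comul_j, ← (Coalgebra.Repr.arbitrary k h).eq]
        simp only [map_sum, TensorProduct.map_tmul, LinearMap.mul'_apply, LinearMap.flip_apply,
          AlgHom.toLinearMap_apply, PiTensorProduct.tprod_mul_tprod, hTj]
        rw [Pi.mul_apply, hd.act_mul_sum _ _ _ _ (Coalgebra.Repr.arbitrary k h).eq.symm,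
          MultilinearMap.map_update_sum]
        refine Finset.sum_congr rfl fun i _ => ?_
        rw [Function.update_mul]
      intro a b
      rw [hTmul, LinearMap.comp_apply, hj, Bialgebra.comul_mul,
        ← (Coalgebra.Repr.arbitrary k x).eq, ← (Coalgebra.Repr.arbitrary k (j l h)).eq]
      simp only [map_sum, TensorProduct.map_tmul, LinearMap.mul'_apply, LinearMap.flip_apply, hx]
      simp only [← (Coalgebra.Repr.arbitrary k x).eq, Finset.sum_mul_sum,
        Algebra.TensorProduct.tmul_mul_tmul, map_sum, TensorProduct.map_tmul, LinearMap.mul'_apply,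
        LinearMap.flip_apply, hTmul, LinearMap.comp_apply]
      rw [Finset.sum_comm]
    · intro x y hx hy a b
      simp only [map_add, LinearMap.add_apply, hx, hy]
    · intro c x hx a b
      simp only [map_smul, LinearMap.smul_apply, hx]
  have hone : ∀ x, T x 1 = Coalgebra.counit (R := k) x • 1 := by
    intro x
    refine hK.ind (p := fun x => T x 1 = Coalgebra.counit (R := k) x • 1) ?_ ?_ ?_ ?_ x
    · intro σ
      rw [PiTensorProduct.one_def, hTπ, hK.counit_π, one_smul]
      rfl
    · intro x l h hx
      have : T (j l h) 1 = Coalgebra.counit (R := k) h • 1 := by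
        rw [PiTensorProduct.one_def, hTj, Pi.one_apply, hd.act_one, MultilinearMap.map_update_smul]
        congr 2
        exact Function.update_eq_self l _
      rw [hTmul, LinearMap.comp_apply, this, map_smul, hx, Bialgebra.counit_mul, hK.counit_j,
        smul_smul, mul_comm]
    · intro x y hx hy
      simp only [map_add, LinearMap.add_apply, hx, hy, add_smul]
    · intro c x hx
      simp only [map_smul, LinearMap.smul_apply, hx, smul_assoc]
  exact ⟨⟨AlgHom.ofLinearMap T hT1 hTmul, hmul, hone⟩, hTt⟩

end SP

section SP
variable {k H K : Type} [Field k] [Ring H] [HopfAlgebra k H] [Ring K] [HopfAlgebra k K] {n : ℕ}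
  {π : Equiv.Perm (Fin n) →* K} {j : Fin n → (H →ₐ[k] K)}

theorem prod_ofFn_formula (i : Fin n) (h : Fin n → H) :
    (List.ofFn fun l => (if l = i then AlgHom.id k H else
      (Algebra.ofId k H).comp (Bialgebra.counitAlgHom k H)) (h l)).prod =
      (∏ l, if l = i then 1 else Coalgebra.counit (R := k) (h l)) • h i := by
  classical
  have hcomm : ∀ l l', l ≠ l' → ∀ x y, Commute ((if l = i then AlgHom.id k H else
      (Algebra.ofId k H).comp (Bialgebra.counitAlgHom k H)) x) ((if l' = i then AlgHom.id k H else
      (Algebra.ofId k H).comp (Bialgebra.counitAlgHom k H)) y) := by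
    intro l l' hl x y
    by_cases h1 : l = i
    · have h2 : l' ≠ i := fun h => hl (h1.trans h.symm)
      rw [if_neg h2]
      exact (Algebra.commutes _ _).symm
    · rw [if_neg h1]
      exact (Algebra.commutes _ _)
  let f1 : (Fin n → H) →* H := MonoidHom.noncommPiCoprod (fun l => (((if l = i then AlgHom.id k H else
      (Algebra.ofId k H).comp (Bialgebra.counitAlgHom k H)) : H →ₐ[k] H) : H →* H))
      (fun l l' hl x y => hcomm l l' hl x y)
  have e1 : f1 h = (List.ofFn fun l => (if l = i then AlgHom.id k H else
      (Algebra.ofId k H).comp (Bialgebra.counitAlgHom k H)) (h l)).prod := by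
    rw [List.ofFn_eq_map, ← Finset.noncommProd_toFinset (List.finRange n) (fun l =>
      (if l = i then AlgHom.id k H else
      (Algebra.ofId k H).comp (Bialgebra.counitAlgHom k H)) (h l))
      (fun i _ i' _ hi => hcomm i i' hi _ _) (List.nodup_finRange n)]
    simp only [List.toFinset_finRange]
    rfl
  let f2 : (Fin n → H) →* H :=
    { toFun := fun h => (∏ l, if l = i then 1 else Coalgebra.counit (R := k) (h l)) • h i
      map_one' := by simp
      map_mul' := by
        intro a b
        rw [Pi.mul_apply, smul_mul_smul_comm, ← Finset.prod_mul_distrib]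
        congr 1
        refine Finset.prod_congr rfl fun l _ => ?_
        split_ifs <;> simp }
  have e2 : f1 = f2 := by
    apply MonoidHom.pi_ext
    intro l x
    refine (MonoidHom.noncommPiCoprod_mulSingle _ _ _).trans ?_
    change (if l = i then AlgHom.id k H else
      (Algebra.ofId k H).comp (Bialgebra.counitAlgHom k H)) x = (∏ l', if l' = i then 1 else
      Coalgebra.counit (R := k) ((Pi.mulSingle l x : Fin n → H) l')) • (Pi.mulSingle l x : Fin n → H) i
    by_cases hl : l = i
    · subst hl
      rw [Finset.prod_eq_one]
      · simp
      · intro l' _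
        split_ifs with h
        · rfl
        · simp [h]
    · rw [Finset.prod_eq_single l]
      · simp [hl, Pi.mulSingle_eq_of_ne (Ne.symm hl), Algebra.smul_def, Algebra.ofId_apply]
      · intro l' _ hl'
        simp [hl']
      · simp
  rw [← e1, e2]; rfl

theorem IsSmashProductPerm.exists_q (hK : IsSmashProductPerm k H K n π j) (i : Fin n) :
    ∃ q : K →ₗ[k] H, ∀ σ h, q (hK.m σ h) = if σ = 1 then
      (∏ l, if l = i then 1 else Coalgebra.counit (R := k) (h l)) • h i else 0 := by
  classical
  obtain ⟨q, hq⟩ := hK.exists_lin (fun σ => if σ = 1 then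
    (MultilinearMap.mkPiAlgebraFin k n H).compLinearMap fun l => (if l = i then AlgHom.id k H else
      (Algebra.ofId k H).comp (Bialgebra.counitAlgHom k H)).toLinearMap else 0)
  refine ⟨q, fun σ h => ?_⟩
  rw [hq]
  split_ifs
  · rw [← prod_ofFn_formula]; rfl
  · rfl

theorem IsSmashProductPerm.antipode_π (hK : IsSmashProductPerm k H K n π j) (σ) :
    HopfAlgebra.antipode k (π σ) = π σ⁻¹ := by
  have h := HopfAlgebra.mul_antipode_rTensor_comul_apply (R := k) (π σ)
  rw [(hK.grouplike σ).2, hK.counit_π, LinearMap.rTensor_tmul, LinearMap.mul'_apply, map_one] at h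
  have h2 : π σ * π σ⁻¹ = 1 := by rw [← map_mul]; simp
  exact left_inv_eq_right_inv h h2

theorem IsSmashProductPerm.antipode_j (hK : IsSmashProductPerm k H K n π j) (l h) :
    HopfAlgebra.antipode k (j l h) = j l (HopfAlgebra.antipode k h) := by
  have h1 : WithConv.toConv (HopfAlgebra.antipode k ∘ₗ (j l).toLinearMap) *
      WithConv.toConv (j l).toLinearMap = 1 := by
    apply WithConv.ofConv_injective
    apply LinearMap.ext
    intro x
    have := HopfAlgebra.mul_antipode_rTensor_comul_apply (R := k) (j l x)
    rw [hK.comul_j, hK.counit_j, ← (Coalgebra.Repr.arbitrary k x).eq] at this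
    change (WithConv.toConv (HopfAlgebra.antipode k ∘ₗ (j l).toLinearMap) *
      WithConv.toConv (j l).toLinearMap) x = algebraMap _ _ (Coalgebra.counit (R := k) x)
    rw [(Coalgebra.Repr.arbitrary k x).convMul_apply, ← this]
    simp
  have h2 : WithConv.toConv (j l).toLinearMap *
      WithConv.toConv ((j l).toLinearMap ∘ₗ HopfAlgebra.antipode k) = 1 := by
    apply WithConv.ofConv_injective
    apply LinearMap.ext
    intro x
    have := congrArg (j l) (HopfAlgebra.mul_antipode_lTensor_comul_apply (R := k) x)
    rw [← (Coalgebra.Repr.arbitrary k x).eq] at this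
    change (WithConv.toConv (j l).toLinearMap *
      WithConv.toConv ((j l).toLinearMap ∘ₗ HopfAlgebra.antipode k)) x =
        algebraMap _ _ (Coalgebra.counit (R := k) x)
    rw [(Coalgebra.Repr.arbitrary k x).convMul_apply]
    simpa using this
  have := left_inv_eq_right_inv h1 h2
  exact congrArg (fun z : WithConv (H →ₗ[k] K) => z h) this

/-- The properties of the projection to the factor `i`. -/
structure IsQ (hK : IsSmashProductPerm k H K n π j) (i : Fin n) (q : K →ₗ[k] H) : Prop where
  hm : ∀ σ h, q (hK.m σ h) = if σ = 1 then
      (∏ l, if l = i then 1 else Coalgebra.counit (R := k) (h l)) • h i else 0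
  hπ : ∀ σ, q (π σ) = if σ = 1 then 1 else 0
  hr : ∀ x h, q (x * j i h) = q x * h
  hr' : ∀ x l h, l ≠ i → q (x * j l h) = Coalgebra.counit (R := k) h • q x
  hl : ∀ x h, q (j i h * x) = h * q x
  hl' : ∀ x l h, l ≠ i → q (j l h * x) = Coalgebra.counit (R := k) h • q x

theorem IsSmashProductPerm.exists_isQ (hK : IsSmashProductPerm k H K n π j) (i : Fin n) :
    ∃ q, IsQ hK i q := by
  classical
  obtain ⟨q, hq⟩ := hK.exists_q i
  have e1 : ∀ (g : Fin n → H) (l : Fin n) (h : H), l ≠ i →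
      (∏ l', if l' = i then 1 else Coalgebra.counit (R := k) ((g * (Pi.mulSingle l h : Fin n → H)) l')) =
      Coalgebra.counit (R := k) h * (∏ l', if l' = i then 1 else Coalgebra.counit (R := k) (g l')) := by
    intro g l h hl
    have : ∀ l', (if l' = i then 1 else Coalgebra.counit (R := k) ((g * (Pi.mulSingle l h : Fin n → H)) l')) =
        (if l' = l then Coalgebra.counit (R := k) h else 1) *
        (if l' = i then 1 else Coalgebra.counit (R := k) (g l')) := by
      intro l'
      by_cases h1 : l' = i
      · subst h1; simp [Ne.symm hl]
      · by_cases h2 : l' = l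
        · subst h2; simp [h1, mul_comm]
        · simp [h1, h2]
    simp only [this, Finset.prod_mul_distrib]
    simp
  have e2 : ∀ (g : Fin n → H) (h : H),
      (∏ l', if l' = i then 1 else Coalgebra.counit (R := k) ((g * (Pi.mulSingle i h : Fin n → H)) l')) =
      (∏ l', if l' = i then 1 else Coalgebra.counit (R := k) (g l')) := by
    intro g h
    refine Finset.prod_congr rfl fun l' _ => ?_
    by_cases h1 : l' = i
    · simp [h1]
    · simp [h1]
  have e1' : ∀ (g : Fin n → H) (l : Fin n) (h : H), l ≠ i →
      (∏ l', if l' = i then 1 else Coalgebra.counit (R := k) (((Pi.mulSingle l h : Fin n → H) * g) l')) =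
      Coalgebra.counit (R := k) h * (∏ l', if l' = i then 1 else Coalgebra.counit (R := k) (g l')) := by
    intro g l h hl
    rw [← e1 g l h hl]
    refine Finset.prod_congr rfl fun l' _ => ?_
    simp [mul_comm]
  have e2' : ∀ (g : Fin n → H) (h : H),
      (∏ l', if l' = i then 1 else Coalgebra.counit (R := k) (((Pi.mulSingle i h : Fin n → H) * g) l')) =
      (∏ l', if l' = i then 1 else Coalgebra.counit (R := k) (g l')) := by
    intro g h
    rw [← e2 g h]
    refine Finset.prod_congr rfl fun l' _ => ?_
    simp [mul_comm]
  refine ⟨q, hq, ?_, ?_, ?_, ?_, ?_⟩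
  · intro σ
    rw [← hK.m_one, hq]
    simp
  · intro x h
    refine hK.ind_m (p := fun x => q (x * j i h) = q x * h) ?_ ?_ ?_ x
    · intro σ g
      rw [hK.m_mul_j, hq, hq, e2]
      split_ifs <;> simp
    · intro x y hx hy; rw [add_mul, map_add, map_add, hx, hy, add_mul]
    · intro c x hx; rw [smul_mul_assoc, map_smul, map_smul, hx, smul_mul_assoc]
  · intro x l h hl
    refine hK.ind_m (p := fun x => q (x * j l h) = Coalgebra.counit (R := k) h • q x) ?_ ?_ ?_ x
    · intro σ g
      rw [hK.m_mul_j, hq, hq, e1 _ _ _ hl]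
      split_ifs <;> simp [mul_smul, Ne.symm hl]
    · intro x y hx hy; rw [add_mul, map_add, map_add, hx, hy, smul_add]
    · intro c x hx; rw [smul_mul_assoc, map_smul, map_smul, hx, smul_comm]
  · intro x h
    refine hK.ind_m (p := fun x => q (j i h * x) = h * q x) ?_ ?_ ?_ x
    · intro σ g
      rw [← hK.m_single, hK.m_mul, hq, hq, one_mul]
      split_ifs with hσ
      · subst hσ
        have : (Pi.mulSingle i h : Fin n → H) ∘ (1 : Equiv.Perm (Fin n)) = Pi.mulSingle i h := rfl
        rw [this, e2']
        simp
      · simp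
    · intro x y hx hy; rw [mul_add, map_add, map_add, hx, hy, mul_add]
    · intro c x hx; rw [mul_smul_comm, map_smul, map_smul, hx, mul_smul_comm]
  · intro x l h hl
    refine hK.ind_m (p := fun x => q (j l h * x) = Coalgebra.counit (R := k) h • q x) ?_ ?_ ?_ x
    · intro σ g
      rw [← hK.m_single, hK.m_mul, hq, hq, one_mul]
      split_ifs with hσ
      · subst hσ
        have : (Pi.mulSingle l h : Fin n → H) ∘ (1 : Equiv.Perm (Fin n)) = Pi.mulSingle l h := rfl
        rw [this, e1' _ _ _ hl]
        simp [mul_smul, Ne.symm hl]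
      · simp
    · intro x y hx hy; rw [mul_add, map_add, map_add, hx, hy, smul_add]
    · intro c x hx; rw [mul_smul_comm, map_smul, map_smul, hx, smul_comm]

theorem IsQ.antipode {hK : IsSmashProductPerm k H K n π j} {i : Fin n} {q : K →ₗ[k] H}
    (hq : IsQ hK i q) (x : K) :
    q (HopfAlgebra.antipode k x) = HopfAlgebra.antipode k (q x) := by
  refine hK.ind (p := fun x => q (HopfAlgebra.antipode k x) = HopfAlgebra.antipode k (q x))
    ?_ ?_ ?_ ?_ x
  · intro σ
    rw [hK.antipode_π, hq.hπ, hq.hπ]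
    simp only [inv_eq_one]
    split_ifs <;> simp
  · intro x l h hx
    rw [HopfAlgebra.antipode_mul_antidistrib, hK.antipode_j]
    by_cases hl : l = i
    · subst hl
      rw [hq.hl, hq.hr, HopfAlgebra.antipode_mul_antidistrib, hx]
    · rw [hq.hl' _ _ _ hl, hq.hr' _ _ _ hl, hx]
      simp
  · intro x y hx hy; simp only [map_add, hx, hy]
  · intro c x hx; simp only [map_smul, hx]

theorem IsQ.comul {hK : IsSmashProductPerm k H K n π j} {i : Fin n} {q : K →ₗ[k] H}
    (hq : IsQ hK i q) (x : K) :
    Coalgebra.comul (R := k) (q x) = TensorProduct.map q q (Coalgebra.comul (R := k) x) := by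
  refine hK.ind (p := fun x => Coalgebra.comul (R := k) (q x) =
    TensorProduct.map q q (Coalgebra.comul (R := k) x)) ?_ ?_ ?_ ?_ x
  · intro σ
    rw [(hK.grouplike σ).2, TensorProduct.map_tmul, hq.hπ]
    split_ifs
    · simp [Algebra.TensorProduct.one_def]
    · simp
  · intro x l h hx
    rw [Bialgebra.comul_mul, hK.comul_j]
    by_cases hl : l = i
    · subst hl
      rw [hq.hr, Bialgebra.comul_mul, hx]
      generalize Coalgebra.comul (R := k) x = a
      generalize Coalgebra.comul (R := k) h = b
      induction a with
      | zero => simp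
      | add a a' h1 h2 => simp only [map_add, add_mul, h1, h2]
      | tmul y z =>
        induction b with
        | zero => simp
        | add a a' h1 h2 => simp only [map_add, mul_add, h1, h2]
        | tmul y' z' => simp [hq.hr]
    · rw [hq.hr' _ _ _ hl, map_smul, hx]
      have hc : Coalgebra.counit (R := k) h = LinearMap.mul' k k
          (TensorProduct.map Coalgebra.counit Coalgebra.counit (Coalgebra.comul (R := k) h)) := by
        have := congrArg (fun z => LinearMap.mul' k k (LinearMap.lTensor k Coalgebra.counit z))
          (Coalgebra.rTensor_counit_comul (R := k) h)
        simp only [LinearMap.lTensor_tmul, LinearMap.mul'_apply, one_mul] at this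
        rw [← this, ← LinearMap.comp_apply (LinearMap.lTensor k _), LinearMap.lTensor_comp_rTensor]
      rw [hc]
      generalize Coalgebra.comul (R := k) x = a
      generalize Coalgebra.comul (R := k) h = b
      induction a with
      | zero => simp
      | add a a' h1 h2 => simp only [map_add, add_mul, smul_add, h1, h2]
      | tmul y z =>
        induction b with
        | zero => simp
        | add a a' h1 h2 => simp only [map_add, mul_add, add_smul, h1, h2]
        | tmul y' z' =>
          simp only [LinearMap.mul'_apply, TensorProduct.map_tmul, AlgHom.toLinearMap_apply,
            Algebra.TensorProduct.tmul_mul_tmul, hq.hr' _ _ _ hl]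
          rw [TensorProduct.smul_tmul_smul]
  · intro x y hx hy; simp only [map_add, hx, hy]
  · intro c x hx; simp only [map_smul, hx]

end SP

section SPF
variable {k H K : Type} [Field k] [Ring H] [HopfAlgebra k H] [Ring K] [HopfAlgebra k K] {n : ℕ}
  {π : Equiv.Perm (Fin n) →* K} {j : Fin n → (H →ₐ[k] K)}

theorem IsQ.act_formula {hK : IsSmashProductPerm k H K n π j} {i : Fin n} {q : K →ₗ[k] H}
    (hq : IsQ hK i q) {L : Type} [Field L] [Algebra k L] (ha : HopfAction k H L)
    (hd : HopfAction k H (L ⊗[k] Polynomial k))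
    (hhd : ∀ h l p, hd.act h (l ⊗ₜ p) = ha.act h l ⊗ₜ p)
    (hA : HopfAction k K (⨂[k] _i : Fin n, (L ⊗[k] Polynomial k)))
    (hhA : ∀ σ h a, hA.act (hK.m σ h) (PiTensorProduct.tprod k a) =
      PiTensorProduct.tprod k (fun i => hd.act (h (σ⁻¹ i)) (a (σ⁻¹ i))))
    (x : K) (hx : hA.act x = 0) : ha.act (q x) = 0 := by
  classical
  ext d
  let c : Fin n → ((L ⊗[k] Polynomial k) →ₗ[k] L) := fun l =>
    (TensorProduct.rid k L).toLinearMap ∘ₗ LinearMap.lTensor L (Polynomial.lcoeff k (l : ℕ))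
  have hc : ∀ l d p, c l (d ⊗ₜ p) = p.coeff (l : ℕ) • d := by
    intro l d p
    simp [c]
  let Φ : (⨂[k] _i : Fin n, (L ⊗[k] Polynomial k)) →ₗ[k] L :=
    PiTensorProduct.lift ((MultilinearMap.mkPiAlgebra k (Fin n) L).compLinearMap c)
  have hΦ : ∀ b : Fin n → (L ⊗[k] Polynomial k), Φ (PiTensorProduct.tprod k b) = ∏ l, c l (b l) := by
    intro b
    simp [Φ]
  let a : Fin n → (L ⊗[k] Polynomial k) := fun l =>
    (if l = i then d else 1) ⊗ₜ[k] (Polynomial.X ^ (l : ℕ))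
  have key : Φ ∘ₗ ((hA.act.toLinearMap : K →ₗ[k] _ →ₗ[k] _).flip (PiTensorProduct.tprod k a)) =
      ((ha.act.toLinearMap : H →ₗ[k] L →ₗ[k] L).flip d) ∘ₗ q := by
    apply hK.lin_ext
    intro σ h
    change Φ (hA.act (hK.m σ h) (PiTensorProduct.tprod k a)) = ha.act (q (hK.m σ h)) d
    rw [hhA, hΦ, hq.hm]
    have hterm : ∀ l l' : Fin n, c l (hd.act (h l') (a l')) =
        if l = l' then ha.act (h l') (if l' = i then d else 1) else 0 := by
      intro l l'
      change c l (hd.act (h l') (_ ⊗ₜ _)) = _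
      rw [hhd, hc, Polynomial.coeff_X_pow]
      by_cases e : l = l'
      · simp [e]
      · have : (l : ℕ) ≠ l' := fun h => e (Fin.ext h)
        simp [e, this]
    by_cases hσ : σ = 1
    · subst hσ
      rw [if_pos rfl]
      have : ∀ l : Fin n, c l (hd.act (h ((1 : Equiv.Perm (Fin n))⁻¹ l)) (a ((1 : Equiv.Perm (Fin n))⁻¹ l))) =
          (if l = i then 1 else Coalgebra.counit (R := k) (h l)) • (if l = i then ha.act (h i) d else 1) := by
        intro l
        refine (hterm l l).trans ?_
        rw [if_pos rfl]
        by_cases e : l = i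
        · subst e; simp
        · simp [e, ha.act_one]
      rw [Finset.prod_congr rfl (fun l _ => this l), Finset.prod_smul]
      simp
    · rw [if_neg hσ]
      have : ∃ l, σ⁻¹ l ≠ l := by
        by_contra hh
        push Not at hh
        apply hσ
        rw [← inv_eq_one]
        ext l
        rw [hh l]; rfl
      obtain ⟨l, hl⟩ := this
      rw [Finset.prod_eq_zero (Finset.mem_univ l)]
      · simp
      · rw [hterm, if_neg (Ne.symm hl)]
  have := LinearMap.congr_fun key x
  change Φ (hA.act x (PiTensorProduct.tprod k a)) = ha.act (q x) d at this
  rw [← this, hx]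
  simp

theorem IsQ.map_mem {hK : IsSmashProductPerm k H K n π j} {i : Fin n} {q : K →ₗ[k] H}
    (hq : IsQ hK i q) {L : Type} [Field L] [Algebra k L] (ha : HopfAction k H L)
    (hf : InnerFaithful k ha.act.toLinearMap) (I : HopfIdeal k K)
    (hI : ∀ x ∈ I.carrier, ha.act (q x) = 0) : ∀ x ∈ I.carrier, q x = 0 := by
  let J : HopfIdeal k H :=
    { carrier := I.carrier.map q
      mul_mem_left := by
        rintro a _ ⟨x, hx, rfl⟩
        exact ⟨_, I.mul_mem_left (j i a) hx, hq.hl x a⟩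
      mul_mem_right := by
        rintro a _ ⟨x, hx, rfl⟩
        exact ⟨_, I.mul_mem_right (j i a) hx, hq.hr x a⟩
      comul_mem := by
        rintro _ ⟨x, hx, rfl⟩
        rw [hq.comul]
        obtain ⟨_, ⟨u, rfl⟩, _, ⟨v, rfl⟩, huv⟩ := Submodule.mem_sup.1 (I.comul_mem x hx)
        rw [← huv, map_add]
        let q' : I.carrier →ₗ[k] I.carrier.map q := q.restrict (fun x hx => ⟨x, hx, rfl⟩)
        refine Submodule.add_mem_sup ⟨TensorProduct.map q' q u, ?_⟩ ⟨TensorProduct.map q q' v, ?_⟩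
        · rw [← LinearMap.comp_apply, ← LinearMap.comp_apply, ← TensorProduct.map_comp,
            ← TensorProduct.map_comp]
          rfl
        · rw [← LinearMap.comp_apply, ← LinearMap.comp_apply, ← TensorProduct.map_comp,
            ← TensorProduct.map_comp]
          rfl
      counit_eq_zero := by
        rintro _ ⟨x, hx, rfl⟩
        have := ha.act_one (q x)
        rw [hI x hx] at this
        simpa using this.symm
      antipode_mem := by
        rintro _ ⟨x, hx, rfl⟩
        exact ⟨_, I.antipode_mem x hx, hq.antipode x⟩ }
  have hJ : J.carrier = ⊥ := hf J (by
    rintro _ ⟨x, hx, rfl⟩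
    exact hI x hx)
  intro x hx
  have : q x ∈ J.carrier := ⟨x, hx, rfl⟩
  rw [hJ] at this
  exact this

theorem IsSmashProductPerm.exists_F (hK : IsSmashProductPerm k H K n π j) (hn : 1 ≤ n)
    (q : Fin n → (K →ₗ[k] H)) (hq : ∀ i, IsQ hK i (q i)) (I : HopfIdeal k K)
    (hI : ∀ i, ∀ x ∈ I.carrier, q i x = 0) (m : ℕ) (hm : m ≤ n) :
    ∃ F : K →ₗ[k] K, (∀ x ∈ I.carrier, F x = 0) ∧ (∀ σ, F (π σ) = if σ = 1 then 1 else 0) ∧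
      (∀ x (l : Fin n) h, (l : ℕ) < m → F (x * j l h) = F x * j l h) ∧
      (∀ x (l : Fin n) h, m ≤ (l : ℕ) → F (x * j l h) = Coalgebra.counit (R := k) h • F x) := by
  induction m with
  | zero =>
    let i0 : Fin n := ⟨0, hn⟩
    refine ⟨(Algebra.linearMap k K) ∘ₗ Coalgebra.counit ∘ₗ q i0, ?_, ?_, ?_, ?_⟩
    · intro x hx
      simp [hI i0 x hx]
    · intro σ
      simp only [LinearMap.comp_apply, (hq i0).hπ]
      split_ifs <;> simp
    · intro x l h hl
      omega
    · intro x l h _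
      simp only [LinearMap.comp_apply]
      by_cases e : l = i0
      · rw [e, (hq i0).hr]
        rw [Bialgebra.counit_mul, Algebra.linearMap_apply, Algebra.linearMap_apply, mul_comm, map_mul,
          Algebra.smul_def]
      · rw [(hq i0).hr' _ _ _ e]
        simp [Algebra.smul_def]
  | succ m ih =>
    obtain ⟨F, hF0, hFπ, hFl, hFg⟩ := ih (by omega)
    let i : Fin n := ⟨m, hm⟩
    let T : K ⊗[k] K →ₗ[k] K := LinearMap.mul' k K ∘ₗ
      TensorProduct.map F ((j i).toLinearMap ∘ₗ q i)
    have hT : ∀ x y, T (x ⊗ₜ y) = F x * j i (q i y) := fun x y => by simp [T]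
    clear_value T
    have hTj : ∀ (l : Fin n) (G : H ⊗[k] H →ₗ[k] K),
        (∀ x y a b, T ((x * j l a) ⊗ₜ (y * j l b)) = T (x ⊗ₜ y) * G (a ⊗ₜ b)) →
        ∀ (u : K ⊗[k] K) (t : H ⊗[k] H),
        T (u * TensorProduct.map (j l).toLinearMap (j l).toLinearMap t) = T u * G t := by
      intro l G hG u t
      induction u using TensorProduct.induction_on with
      | zero => simp
      | add u v hu hv => simp only [add_mul, map_add, hu, hv]
      | tmul x y =>
        induction t using TensorProduct.induction_on with
        | zero => simp
        | add u v hu hv => simp only [mul_add, map_add, hu, hv]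
        | tmul a b =>
          rw [← hG]
          simp
    have hTc : ∀ x (l : Fin n) h, Coalgebra.comul (R := k) (x * j l h) =
        Coalgebra.comul x * TensorProduct.map (j l).toLinearMap (j l).toLinearMap
          (Coalgebra.comul (R := k) h) := by
      intro x l h
      rw [Bialgebra.comul_mul, hK.comul_j]
    have hq' : ∀ y (l : Fin n) b, l ≠ i → q i (y * j l b) = Coalgebra.counit (R := k) b • q i y :=
      fun y l b e => (hq i).hr' y l b e
    refine ⟨T ∘ₗ Coalgebra.comul, ?_, ?_, ?_, ?_⟩
    · intro x hx
      obtain ⟨_, ⟨u, rfl⟩, _, ⟨v, rfl⟩, huv⟩ := Submodule.mem_sup.1 (I.comul_mem x hx)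
      rw [LinearMap.comp_apply, ← huv, map_add]
      have h1 : T ∘ₗ TensorProduct.map I.carrier.subtype LinearMap.id = 0 := by
        ext x y
        simp [hT, hF0 x x.2]
      have h2 : T ∘ₗ TensorProduct.map LinearMap.id I.carrier.subtype = 0 := by
        ext x y
        simp [hT, hI i y y.2]
      have e1 := LinearMap.congr_fun h1 u
      have e2 := LinearMap.congr_fun h2 v
      rw [LinearMap.comp_apply] at e1 e2
      rw [e1, e2]
      simp
    · intro σ
      rw [LinearMap.comp_apply, (hK.grouplike σ).2, hT, hFπ, (hq i).hπ]
      split_ifs <;> simp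
    · intro x l h hl
      rw [LinearMap.comp_apply, LinearMap.comp_apply, hTc]
      by_cases e : l = i
      · subst e
        rw [hTj i ((j i).toLinearMap ∘ₗ (TensorProduct.lid k H).toLinearMap ∘ₗ
          LinearMap.rTensor H Coalgebra.counit)]
        · simp
        · intro x y a b
          rw [hT, hT, hFg _ _ _ le_rfl, (hq i).hr]
          simp [mul_assoc]
      · have hlm : (l : ℕ) < m := by
          have : (l : ℕ) ≠ m := fun h => e (Fin.ext h)
          omega
        rw [hTj l ((j l).toLinearMap ∘ₗ (TensorProduct.rid k H).toLinearMap ∘ₗ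
          LinearMap.lTensor H Coalgebra.counit)]
        · simp
        · intro x y a b
          rw [hT, hT, hFl _ _ _ hlm, hq' _ _ _ e]
          simp [mul_assoc, hK.commute_j l i e]
    · intro x l h hl
      rw [LinearMap.comp_apply, LinearMap.comp_apply, hTc]
      have e : l ≠ i := by
        rintro rfl
        simp [i] at hl
      rw [hTj l ((Algebra.linearMap k K) ∘ₗ Coalgebra.counit ∘ₗ (TensorProduct.rid k H).toLinearMap ∘ₗ
          LinearMap.lTensor H Coalgebra.counit)]
      · simp [Algebra.smul_def, Algebra.commutes]
      · intro x y a b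
        rw [hT, hT, hFg _ _ _ (by omega), hq' _ _ _ e]
        simp only [map_smul, smul_mul_smul_comm, LinearMap.comp_apply, LinearMap.lTensor_tmul]
        rw [LinearEquiv.coe_coe, TensorProduct.rid_tmul, map_smul, smul_eq_mul,
          Algebra.linearMap_apply, ← Algebra.commutes, ← Algebra.smul_def, mul_comm]

theorem IsSmashProductPerm.ideal_eq_bot (hK : IsSmashProductPerm k H K n π j) (hn : 1 ≤ n)
    (q : Fin n → (K →ₗ[k] H)) (hq : ∀ i, IsQ hK i (q i)) (I : HopfIdeal k K)
    (hI : ∀ i, ∀ x ∈ I.carrier, q i x = 0) : I.carrier = ⊥ := by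
  classical
  obtain ⟨F, hF0, hFπ, hFl, -⟩ := hK.exists_F hn q hq I hI n le_rfl
  have key : ∀ x : K, x = ∑ σ, π σ * F (π σ⁻¹ * x) := by
    refine hK.ind ?_ ?_ ?_ ?_
    · intro τ
      rw [Finset.sum_eq_single τ]
      · rw [← map_mul, hFπ]; simp
      · intro σ _ hσ
        rw [← map_mul, hFπ, if_neg, mul_zero]
        intro h
        exact hσ (inv_mul_eq_one.1 h)
      · simp
    · intro x l h hx
      simp only [← mul_assoc]
      simp only [hFl _ _ _ l.2]
      simp only [← mul_assoc]
      rw [← Finset.sum_mul, ← hx]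
    · intro x y hx hy
      simp only [mul_add, map_add, Finset.sum_add_distrib]
      rw [← hx, ← hy]
    · intro c x hx
      simp only [mul_smul_comm, map_smul, ← Finset.smul_sum]
      rw [← hx]
  rw [Submodule.eq_bot_iff]
  intro x hx
  rw [key x]
  refine Finset.sum_eq_zero fun σ _ => ?_
  rw [hF0 _ (I.mul_mem_left _ hx), mul_zero]

end SPF

/-- **Statement 4.** If `H` is Galois-theoretical, then so is the semidirect (smash) product
Hopf algebra `k S_n ⋉ H^{⊗ n}` (any Hopf algebra `K` realizing it), for all `n ≥ 1`. -/
theorem galoisTheoretical_smashProduct_perm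
    (k : Type) [Field k] [IsAlgClosed k] [CharZero k]
    (H : Type) [Ring H] [HopfAlgebra k H]
    (n : ℕ) (hn : 1 ≤ n)
    (K : Type) [Ring K] [HopfAlgebra k K]
    (π : Equiv.Perm (Fin n) →* K) (j : Fin n → (H →ₐ[k] K))
    (hK : IsSmashProductPerm k H K n π j)
    (hGT : GaloisTheoretical k H) :
    GaloisTheoretical k K := by
  obtain ⟨⟨L, ha, hf⟩⟩ := hGT
  obtain ⟨hd, hhd⟩ := ha.tensorPoly (Polynomial k)
  have : IsDomain (L ⊗[k] Polynomial k) := isDomain_tensor L (Polynomial k)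
  obtain ⟨hA, hhA⟩ := hK.exists_action hd
  have : IsDomain (⨂[k] _i : Fin n, (L ⊗[k] Polynomial k)) := isDomain_pi _ n
  obtain ⟨hB, hhB⟩ := hA.extend
  choose q hq using hK.exists_isQ
  refine ⟨{ L := FractionRing (⨂[k] _i : Fin n, (L ⊗[k] Polynomial k)), action := hB, faithful := ?_ }⟩
  intro I hI
  refine hK.ideal_eq_bot hn q hq I fun i => (hq i).map_mem ha hf I fun x hx => ?_
  refine (hq i).act_formula ha hd hhd hA hhA x ?_
  refine LinearMap.ext fun a => ?_
  apply IsFractionRing.injective (⨂[k] _i : Fin n, (L ⊗[k] Polynomial k))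
    (FractionRing (⨂[k] _i : Fin n, (L ⊗[k] Polynomial k)))
  rw [← hhB]
  have : hB.act x = 0 := hI x hx
  rw [this]
  simp
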